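/- arXiv:2005.12363 — 3 statements merged into one kernel-verified Lean document; each statement's English description precedes it below -/
import Mathlib

section
/- Let w be a complex number with Re(w) > −1 and let z be any complex number. Then binom(w, z) = Σ_{k=0}^{∞} binom(w, k) · sinc(z − k), where the series converges. -/
open scoped Real

/-- The generalized binomial coefficient `binom w z = Γ(w+1) / (Γ(z+1) Γ(w-z+1))`. -/
noncomputable def cbinom (w z : ℂ) : ℂ :=
  Complex.Gamma (w + 1) / (Complex.Gamma (z + 1) * Complex.Gamma (w - z + 1))

/-- The (normalized) sinc function on ℂ. -/
noncomputable def csinc (z : ℂ) : ℂ :=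
  if z = 0 then 1 else Complex.sin (π * z) / (π * z)

open Filter Topology Asymptotics MeasureTheory Set

/-- The coefficients `(-1)^k * binom(w, k)` of the power series of `(1 - x)^w`. -/
noncomputable def signedChoose (w : ℂ) (k : ℕ) : ℂ :=
  (-1) ^ k * Ring.choose w k

theorem choose_succ_mul (w : ℂ) (k : ℕ) :
    Ring.choose w (k + 1) * (k + 1) = Ring.choose w k * (w - k) := by
  have hk : (k.factorial : ℂ) ≠ 0 := by exact_mod_cast k.factorial_ne_zero
  have hk1 : (k + 1 : ℂ) ≠ 0 := by exact_mod_cast k.succ_ne_zero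
  simp only [Ring.choose_eq_smul, descPochhammer_succ_right, Polynomial.smeval_mul,
    Polynomial.smeval_sub, Polynomial.smeval_X, Polynomial.smeval_natCast, smul_eq_mul,
    Nat.factorial_succ, pow_one, pow_zero, nsmul_eq_mul, mul_one]
  push_cast
  field_simp

theorem signedChoose_succ_mul (w : ℂ) (k : ℕ) :
    signedChoose w (k + 1) * (k + 1) = signedChoose w k * (k - w) := by
  simp only [signedChoose, pow_succ]
  linear_combination (-(-1) ^ k) * choose_succ_mul w k

theorem cbinom_natCast (w : ℂ) (hw : -1 < w.re) (k : ℕ) : cbinom w k = Ring.choose w k := by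
  have hΓ : Complex.Gamma (w + 1) ≠ 0 :=
    Complex.Gamma_ne_zero_of_re_pos (by simp; linarith)
  induction k with
  | zero => simp [cbinom, hΓ]
  | succ k ih =>
    have hk1 : (k + 1 : ℂ) ≠ 0 := by exact_mod_cast k.succ_ne_zero
    apply mul_right_cancel₀ hk1
    rw [choose_succ_mul, ← ih, cbinom, cbinom]
    have h1 := Complex.one_div_Gamma_eq_self_mul_one_div_Gamma_add_one (w - k)
    have h2 := Complex.Gamma_add_one (k + 1 : ℂ) hk1
    push_cast
    rw [h2, show w - (k + 1) + 1 = w - k by ring]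
    simp only [div_eq_mul_inv, mul_inv] at h1 ⊢
    rw [h1]
    field_simp

theorem signedChoose_succ_eq_prod (w : ℂ) (n : ℕ) :
    signedChoose w (n + 1) = (∏ j ∈ Finset.range (n + 1), (-w + j)) / (n + 1).factorial := by
  rw [eq_div_iff (by exact_mod_cast (n + 1).factorial_ne_zero)]
  induction n with
  | zero => simp [signedChoose]
  | succ n ih =>
    rw [Finset.prod_range_succ, ← ih, Nat.factorial_succ (n + 1)]
    have := signedChoose_succ_mul w (n + 1)
    push_cast at this ⊢
    linear_combination (((n + 1).factorial : ℕ) : ℂ) * this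

theorem signedChoose_succ_eq_inv_GammaSeq (w : ℂ) {n : ℕ} (hn : n ≠ 0) :
    signedChoose w (n + 1) = (n : ℂ) ^ (-w) / (n + 1) * (Complex.GammaSeq (-w) n)⁻¹ := by
  have hpow : (n : ℂ) ^ (-w) ≠ 0 := by simp [Complex.cpow_eq_zero_iff, hn]
  have hf : (n.factorial : ℂ) ≠ 0 := by exact_mod_cast n.factorial_ne_zero
  have hn1 : (n + 1 : ℂ) ≠ 0 := by exact_mod_cast n.succ_ne_zero
  rw [signedChoose_succ_eq_prod, Complex.GammaSeq, inv_div, Nat.factorial_succ]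
  push_cast
  field_simp

theorem signedChoose_succ_isBigO (w : ℂ) :
    (fun n : ℕ => signedChoose w (n + 1)) =O[atTop] fun n : ℕ => (n : ℝ) ^ (-w.re - 1) := by
  by_cases hw : ∃ m : ℕ, w = m
  · obtain ⟨m, rfl⟩ := hw
    refine IsBigO.of_bound 1 ?_
    filter_upwards [eventually_ge_atTop m] with n hn
    rw [signedChoose, Ring.choose_natCast, Nat.choose_eq_zero_of_lt (by lia)]
    simp only [Nat.cast_zero, mul_zero, norm_zero]
    positivity
  · have hΓ : Complex.Gamma (-w) ≠ 0 :=
      Complex.Gamma_ne_zero fun m hm => hw ⟨m, neg_injective hm⟩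
    have h1 : (fun n : ℕ => (Complex.GammaSeq (-w) n)⁻¹) =O[atTop] fun _ : ℕ => (1 : ℝ) :=
      ((Complex.GammaSeq_tendsto_Gamma (-w)).inv₀ hΓ).isBigO_one ℝ
    have h2 : (fun n : ℕ => (n : ℂ) ^ (-w) / (n + 1)) =O[atTop]
        fun n : ℕ => (n : ℝ) ^ (-w.re - 1) := by
      refine IsBigO.of_bound 1 ?_
      filter_upwards [eventually_ge_atTop 1] with n hn
      have hn0 : (0 : ℝ) < n := by exact_mod_cast hn
      rw [norm_div, Complex.norm_natCast_cpow_of_pos hn, Complex.neg_re, one_mul,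
        Real.norm_of_nonneg (by positivity), Real.rpow_sub_one hn0.ne']
      have : ‖(n + 1 : ℂ)‖ = n + 1 := by
        rw [← Nat.cast_succ, Complex.norm_natCast]; simp
      rw [this]
      gcongr
      linarith
    have h3 := h2.mul h1
    simp only [mul_one] at h3
    refine h3.congr' ?_ EventuallyEq.rfl
    filter_upwards [eventually_ne_atTop 0] with n hn
    exact (signedChoose_succ_eq_inv_GammaSeq w hn).symm

theorem inv_add_natCast_isBigO (s : ℂ) :
    (fun n : ℕ => (s + n)⁻¹) =O[atTop] fun n : ℕ => ((n : ℝ))⁻¹ := by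
  refine IsBigO.of_bound 2 ?_
  filter_upwards [eventually_ge_atTop (⌈2 * ‖s‖⌉₊ + 1)] with n hn
  have h1 : 2 * ‖s‖ ≤ n := (Nat.le_ceil _).trans (by exact_mod_cast (by lia))
  have hn0 : (0 : ℝ) < n := by exact_mod_cast (by lia)
  have h2 : (n : ℝ) / 2 ≤ ‖s + n‖ := by
    have := norm_sub_norm_le (n : ℂ) (-s)
    rw [Complex.norm_natCast, norm_neg, sub_neg_eq_add, add_comm] at this
    linarith
  rw [norm_inv, norm_inv, Real.norm_of_nonneg hn0.le]
  calc ‖s + n‖⁻¹ ≤ ((n : ℝ) / 2)⁻¹ := by gcongr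
    _ = 2 * (n : ℝ)⁻¹ := by rw [inv_div, div_eq_mul_inv]

theorem tendsto_signedChoose {w : ℂ} (hw : -1 < w.re) :
    Tendsto (signedChoose w) atTop (𝓝 0) := by
  rw [← tendsto_add_atTop_iff_nat 1]
  refine (signedChoose_succ_isBigO w).trans_tendsto ?_
  have h := (tendsto_rpow_neg_atTop (y := w.re + 1) (by linarith)).comp
    (tendsto_natCast_atTop_atTop (R := ℝ))
  simpa [Function.comp_def, neg_add, ← sub_eq_add_neg, add_comm] using h

theorem summable_signedChoose_div {w : ℂ} (hw : -1 < w.re) (s : ℂ) :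
    Summable fun k : ℕ => signedChoose w k / (s + k) := by
  rw [← summable_nat_add_iff 1]
  have h := (signedChoose_succ_isBigO w).mul (inv_add_natCast_isBigO (s + 1))
  refine summable_of_isBigO_nat
    (g := fun n : ℕ => (n : ℝ) ^ (-w.re - 1) * (n : ℝ)⁻¹) ?_ ?_
  · have : Summable fun n : ℕ => (n : ℝ) ^ (-w.re - 2) :=
      Real.summable_nat_rpow.2 (by linarith)
    refine this.congr_atTop ?_
    filter_upwards [eventually_gt_atTop 0] with n hn
    have hn0 : (0 : ℝ) < n := by exact_mod_cast hn
    rw [← Real.rpow_neg_one, ← Real.rpow_add hn0]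
    congr 1
    ring
  · refine h.congr_left fun n => ?_
    push_cast
    rw [div_eq_mul_inv]
    congr 2
    ring

theorem hasSum_one_sub_cpow (w : ℂ) {x : ℝ} (hx : x ∈ Ioo (0 : ℝ) 1) :
    HasSum (fun k : ℕ => signedChoose w k * (x : ℂ) ^ k) ((1 - (x : ℂ)) ^ w) := by
  have h := (Complex.one_add_cpow_hasFPowerSeriesOnBall_zero (a := w)).hasSum (y := -(x : ℂ))
    (by simpa [Metric.mem_eball, edist_dist, abs_of_pos hx.1] using hx.2)
  rw [zero_add] at h
  simp only [binomialSeries_apply, List.ofFn_const, List.prod_replicate,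
    smul_eq_mul, ← sub_eq_add_neg] at h
  refine h.congr_fun ?_
  intro k
  rw [signedChoose, neg_pow (x : ℂ)]
  ring

theorem hasSum_signedChoose_div_eq_betaIntegral {w s : ℂ} (hw : -1 < w.re) (hs : 0 < s.re) :
    HasSum (fun k : ℕ => signedChoose w k / (s + k)) (Complex.betaIntegral s (w + 1)) := by
  have hre (k : ℕ) : -1 < (s + k - 1).re := by
    simp only [Complex.sub_re, Complex.add_re, Complex.natCast_re, Complex.one_re]
    have : (0 : ℝ) ≤ k := k.cast_nonneg
    linarith
  have hsum : Summable fun k : ℕ => ‖signedChoose w k‖ / (s.re + k) := by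
    refine (summable_signedChoose_div hw (s.re : ℂ)).norm.congr fun k => ?_
    rw [norm_div]
    congr 1
    have : (0 : ℝ) ≤ s.re + k := by positivity
    rw [← Complex.ofReal_natCast, ← Complex.ofReal_add, Complex.norm_real,
      Real.norm_of_nonneg this]
  have key := hasSum_integral_of_summable_integral_norm (μ := volume.restrict (Ioc (0 : ℝ) 1))
    (F := fun (k : ℕ) (x : ℝ) => signedChoose w k * (x : ℂ) ^ (s + k - 1)) ?_ ?_
  · have hB : Complex.betaIntegral s (w + 1) =
        ∫ x in Ioc (0 : ℝ) 1, ∑' k : ℕ, signedChoose w k * (x : ℂ) ^ (s + k - 1) := by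
      rw [Complex.betaIntegral, intervalIntegral.integral_of_le zero_le_one,
        integral_Ioc_eq_integral_Ioo, integral_Ioc_eq_integral_Ioo]
      refine setIntegral_congr_fun measurableSet_Ioo fun x hx => ?_
      have hx0 : (x : ℂ) ≠ 0 := by exact_mod_cast hx.1.ne'
      have h := ((hasSum_one_sub_cpow w hx).mul_left ((x : ℂ) ^ (s - 1))).tsum_eq
      simp only [add_sub_cancel_right]
      rw [← h]
      refine tsum_congr fun k => ?_
      rw [show s + k - 1 = s - 1 + k by ring, Complex.cpow_add _ _ hx0, Complex.cpow_natCast]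
      ring
    rw [hB]
    refine key.congr_fun fun k => ?_
    rw [← intervalIntegral.integral_of_le zero_le_one, intervalIntegral.integral_const_mul,
      integral_cpow (Or.inl (hre k))]
    have : s + k ≠ 0 := fun h => by
      have := hre k
      simp [h] at this
    simp [Complex.zero_cpow this, div_eq_mul_inv]
  · intro k
    refine Integrable.const_mul ?_ _
    have := intervalIntegral.intervalIntegrable_cpow' (a := 0) (b := 1) (hre k)
    exact (intervalIntegrable_iff_integrableOn_Ioc_of_le zero_le_one).1 this
  · refine hsum.congr fun k => ?_
    have h1 : ∀ x ∈ Ioc (0 : ℝ) 1, ‖signedChoose w k * (x : ℂ) ^ (s + k - 1)‖ =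
        ‖signedChoose w k‖ * x ^ (s.re + k - 1) := fun x hx => by
      rw [norm_mul, Complex.norm_cpow_eq_rpow_re_of_pos hx.1]
      simp
    rw [setIntegral_congr_fun measurableSet_Ioc h1,
      ← intervalIntegral.integral_of_le zero_le_one, intervalIntegral.integral_const_mul,
      integral_rpow (Or.inl (by simpa using hre k))]
    have : s.re + k ≠ 0 := by positivity
    simp [Real.zero_rpow this, div_eq_mul_inv]

theorem hasSum_signedChoose_div_step {w s : ℂ} (hw : -1 < w.re) (hs : ∀ k : ℕ, s ≠ -k) :
    HasSum (fun k : ℕ => s * (signedChoose w k / (s + k)) -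
      (w + s + 1) * (signedChoose w k / (s + 1 + k))) 0 := by
  have hne (k : ℕ) : s + k ≠ 0 := fun h => hs k (eq_neg_of_add_eq_zero_left h)
  rw [(((summable_signedChoose_div hw s).mul_left s).sub
    ((summable_signedChoose_div hw (s + 1)).mul_left (w + s + 1))).hasSum_iff_tendsto_nat]
  have hpart (n : ℕ) : ∑ k ∈ Finset.range n, (s * (signedChoose w k / (s + k)) -
      (w + s + 1) * (signedChoose w k / (s + 1 + k))) =
      signedChoose w n - s * (signedChoose w n / (s + n)) := by
    induction n with
    | zero =>
      have : s ≠ 0 := by simpa using hne 0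
      simp [mul_div_cancel₀, this, mul_div_assoc']
    | succ n ih =>
      have h1 : s + 1 + n ≠ 0 := by
        have := hne (n + 1)
        push_cast at this
        rwa [add_assoc, add_comm 1]
      have h2 := signedChoose_succ_mul w n
      rw [Finset.sum_range_succ, ih]
      push_cast
      rw [show s + ((n : ℂ) + 1) = s + 1 + n by ring]
      have := hne n
      field_simp
      linear_combination -(s + n) * h2
  simp only [hpart]
  simpa using (tendsto_signedChoose hw).sub
    ((summable_signedChoose_div hw s).tendsto_atTop_zero.const_mul s)

theorem hasSum_signedChoose_div {w s : ℂ} (hw : -1 < w.re) (hs : ∀ k : ℕ, s ≠ -k) :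
    HasSum (fun k : ℕ => signedChoose w k / (s + k))
      (Complex.Gamma s * Complex.Gamma (w + 1) / Complex.Gamma (s + w + 1)) := by
  obtain ⟨n, hn⟩ := exists_nat_gt (-s.re)
  induction n generalizing s with
  | zero =>
    have hs0 : 0 < s.re := by simpa using hn
    have hw1 : 0 < (w + 1).re := by simp; linarith
    convert! hasSum_signedChoose_div_eq_betaIntegral hw hs0 using 1
    rw [Complex.Gamma_mul_Gamma_eq_betaIntegral hs0 hw1, ← add_assoc, mul_div_cancel_left₀]
    exact Complex.Gamma_ne_zero_of_re_pos (by simp at hw1 ⊢; linarith)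
  | succ n ih =>
    have hs0 : s ≠ 0 := by simpa using hs 0
    have h1 := ih (s := s + 1)
      (fun k hk => hs (k + 1) (by push_cast; linear_combination hk))
      (by push_cast at hn; simp; linarith)
    have h2 := (hasSum_signedChoose_div_step hw hs).add (h1.mul_left (w + s + 1))
    simp only [sub_add_cancel] at h2
    have h3 := h2.mul_left s⁻¹
    simp only [inv_mul_cancel_left₀ hs0] at h3
    convert! h3 using 1
    have h4 := Complex.one_div_Gamma_eq_self_mul_one_div_Gamma_add_one (s + w + 1)
    rw [Complex.Gamma_add_one s hs0]
    simp only [div_eq_mul_inv] at h4 ⊢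
    rw [h4, show s + 1 + w + 1 = s + w + 1 + 1 by ring]
    field_simp
    ring

theorem csinc_natCast_sub_natCast (m k : ℕ) :
    csinc ((m : ℂ) - k) = if k = m then 1 else 0 := by
  split_ifs with h
  · simp [csinc, h]
  · have : (m : ℂ) - k ≠ 0 := sub_ne_zero.2 (by exact_mod_cast Ne.symm h)
    rw [csinc, if_neg this, mul_comm (π : ℂ)]
    have h2 := Complex.sin_int_mul_pi ((m : ℤ) - k)
    push_cast at h2
    rw [h2, zero_div]

theorem sin_pi_mul_sub_natCast (z : ℂ) (k : ℕ) :
    Complex.sin (π * (z - k)) = (-1) ^ k * Complex.sin (π * z) := by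
  rw [mul_sub, mul_comm (π : ℂ) k]
  exact Complex.sin_antiperiodic.sub_nat_mul_eq k

theorem binom_eq_series_sinc (w : ℂ) (hw : -1 < w.re) (z : ℂ) :
    HasSum (fun k : ℕ => cbinom w (k : ℂ) * csinc (z - k)) (cbinom w z) := by
  have hpi : (π : ℂ) ≠ 0 := by exact_mod_cast Real.pi_ne_zero
  by_cases hz : ∃ m : ℕ, z = m
  · obtain ⟨m, rfl⟩ := hz
    simp only [csinc_natCast_sub_natCast, mul_ite, mul_one, mul_zero]
    simpa using hasSum_single (f := fun k : ℕ => if k = m then cbinom w k else 0) m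
      (by simp +contextual)
  · have hs (k : ℕ) : -z ≠ -k := fun h => hz ⟨k, neg_injective h⟩
    convert! (hasSum_signedChoose_div hw hs).mul_left (-(Complex.sin (π * z) / π)) using 1
    · ext k
      have hk : z - k ≠ 0 := fun h => hz ⟨k, sub_eq_zero.1 h⟩
      have hk' : -z + k ≠ 0 := fun h => hk (by linear_combination -h)
      rw [cbinom_natCast w hw, csinc, if_neg hk, sin_pi_mul_sub_natCast, signedChoose]
      field_simp
      ring
    · have hrefl : (Complex.Gamma (z + 1))⁻¹ =
          -(Complex.sin (π * z) / π) * Complex.Gamma (-z) := by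
        have h := congrArg (·⁻¹) (Complex.Gamma_mul_Gamma_one_sub (-z))
        simp only [sub_neg_eq_add, add_comm 1 z, mul_neg, Complex.sin_neg, mul_inv, inv_div,
          neg_div] at h
        rw [← h, mul_comm, mul_inv_cancel_left₀ (Complex.Gamma_ne_zero hs)]
      rw [cbinom, show -z + w + 1 = w - z + 1 by ring]
      simp only [div_eq_mul_inv, mul_inv] at hrefl ⊢
      rw [hrefl]
      ring
end

section
/- Let w be a complex number with Re(w) > −1 and let f : ℝ → ℂ be integrable (f ∈ L¹(ℝ)). Then ∫_{−∞}^{∞} binom(w, x) · f(x) dx = Σ_{k=0}^{∞} binom(w, k) · ∫_{−1/2}^{1/2} f̂(ξ) · e^{2πiξk} dξ, where f̂ denotes the Fourier transform of f. -/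
open scoped Real FourierTransform
open MeasureTheory

theorem cbinom_zero_right {w : ℂ} (hw : -1 < w.re) : cbinom w 0 = 1 := by
  have h : Complex.Gamma (w + 1) ≠ 0 :=
    Complex.Gamma_ne_zero_of_re_pos (by simp; linarith)
  simp [cbinom, h]

theorem cbinom_succ_mul (w : ℂ) (k : ℕ) :
    cbinom w (k + 1 : ℕ) * (k + 1) = (w - k) * cbinom w k := by
  have hk : (k + 1 : ℂ) ≠ 0 := Nat.cast_add_one_ne_zero k
  have h := Complex.one_div_Gamma_eq_self_mul_one_div_Gamma_add_one (w - k)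
  simp only [cbinom, div_eq_mul_inv, mul_inv]
  rw [show w - ((k + 1 : ℕ) : ℂ) + 1 = w - k by push_cast; ring, h,
    show (((k + 1 : ℕ) : ℂ) + 1) = (k + 1) + 1 by push_cast; ring,
    Complex.Gamma_add_one _ hk]
  field_simp

theorem cbinom_natCast_eq_choose {w : ℂ} (hw : -1 < w.re) (k : ℕ) :
    cbinom w k = Ring.choose w k := by
  induction k with
  | zero => simpa using cbinom_zero_right hw
  | succ k ih =>
    have hk : (k + 1 : ℂ) ≠ 0 := Nat.cast_add_one_ne_zero k
    have hf : (k.factorial : ℂ) ≠ 0 := Nat.cast_ne_zero.2 k.factorial_ne_zero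
    have h₁ := Ring.descPochhammer_eq_factorial_smul_choose w k
    have h₂ := Ring.descPochhammer_eq_factorial_smul_choose w (k + 1)
    rw [descPochhammer_succ_right, Polynomial.smeval_mul, h₁] at h₂
    simp only [Polynomial.smeval_sub, Polynomial.smeval_X, Polynomial.smeval_natCast, pow_one,
      pow_zero, nsmul_eq_mul, mul_one, Nat.factorial_succ] at h₂
    push_cast at h₂
    apply mul_right_cancel₀ hk
    rw [cbinom_succ_mul, ih]
    apply mul_left_cancel₀ hf
    linear_combination h₂

/-- The ratio of consecutive binomial coefficients is eventually at most `1 - s / (k + 1)`. -/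
theorem eventually_norm_sub_natCast_le {w : ℂ} {s : ℝ} (hs : s < w.re + 1) :
    ∀ᶠ k : ℕ in Filter.atTop, ‖w - k‖ ≤ k + 1 - s := by
  have hpos : 0 < 2 * (w.re + 1 - s) := by linarith
  filter_upwards [(tendsto_natCast_atTop_atTop (R := ℝ)).eventually_ge_atTop
    ((w.re ^ 2 + w.im ^ 2 - (1 - s) ^ 2) / (2 * (w.re + 1 - s))),
    (tendsto_natCast_atTop_atTop (R := ℝ)).eventually_ge_atTop s] with k hk hks
  rw [div_le_iff₀ hpos] at hk
  apply le_of_sq_le_sq _ (by linarith)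
  rw [Complex.sq_norm, Complex.normSq_apply]
  simp
  nlinarith

/-- Binomial coefficients decay like a negative power. -/
theorem exists_norm_cbinom_natCast_le {w : ℂ} {s : ℝ} (hs₀ : 0 ≤ s) (hs₁ : s ≤ 1)
    (hs : s < w.re + 1) :
    ∃ C, ∀ k : ℕ, ‖cbinom w k‖ * ((k : ℝ) + 1) ^ s ≤ C := by
  obtain ⟨N, hN⟩ := Filter.eventually_atTop.1 (eventually_norm_sub_natCast_le hs)
  set d : ℕ → ℝ := fun k => ‖cbinom w k‖ * ((k : ℝ) + 1) ^ s with hd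
  have step : ∀ k ≥ N, d (k + 1) ≤ d k := by
    intro k hk
    have hk0 : (0 : ℝ) < k + 1 := by positivity
    have h₁ : ‖cbinom w (k + 1 : ℕ)‖ * (k + 1) = ‖w - k‖ * ‖cbinom w k‖ := by
      rw [← norm_mul, ← cbinom_succ_mul, norm_mul]
      congr 1
      exact_mod_cast (Complex.norm_natCast (k + 1)).symm
    have h₂ : ((k + 1 : ℕ) + 1 : ℝ) ^ s ≤ (1 + s / (k + 1)) * ((k : ℝ) + 1) ^ s := by
      have e : ((k + 1 : ℕ) + 1 : ℝ) = (1 + 1 / (k + 1)) * (k + 1) := by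
        push_cast; field_simp
      rw [e, Real.mul_rpow (by positivity) hk0.le]
      gcongr
      have := rpow_one_add_le_one_add_mul_self (s := 1 / ((k : ℝ) + 1)) (p := s)
        (by have : (0:ℝ) ≤ 1 / ((k : ℝ) + 1) := by positivity
            linarith) hs₀ hs₁
      simpa [div_eq_mul_inv] using this
    have h₃ : ‖w - k‖ * (1 + s / (k + 1)) ≤ k + 1 := by
      calc ‖w - k‖ * (1 + s / (k + 1)) ≤ (k + 1 - s) * (1 + s / (k + 1)) := by
            gcongr; exact hN k hk
        _ = (k + 1) - s ^ 2 / (k + 1) := by field_simp; ring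
        _ ≤ k + 1 := by
            have : 0 ≤ s ^ 2 / ((k : ℝ) + 1) := by positivity
            linarith
    apply le_of_mul_le_mul_right _ hk0
    calc d (k + 1) * (k + 1)
        = (‖cbinom w (k + 1 : ℕ)‖ * (k + 1)) * ((k + 1 : ℕ) + 1 : ℝ) ^ s := by
          simp only [hd]; ring
      _ ≤ (‖w - k‖ * ‖cbinom w k‖) * ((1 + s / (k + 1)) * ((k : ℝ) + 1) ^ s) := by
          rw [h₁]; gcongr
      _ = (‖w - k‖ * (1 + s / (k + 1))) * d k := by simp only [hd]; ring
      _ ≤ (k + 1) * d k := by gcongr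
      _ = d k * (k + 1) := mul_comm _ _
  refine ⟨∑ i ∈ Finset.range (N + 1), d i, fun k => ?_⟩
  have hd0 : ∀ i, 0 ≤ d i := fun i => by positivity
  have hle : ∀ i ≤ N, d i ≤ ∑ i ∈ Finset.range (N + 1), d i := fun i hi =>
    Finset.single_le_sum (fun i _ => hd0 i) (Finset.mem_range.2 (by omega))
  rcases le_total k N with h | h
  · exact hle k h
  · refine le_trans ?_ (hle N le_rfl)
    induction k, h using Nat.le_induction with
    | base => exact le_rfl
    | succ k hk ih => exact (step k hk).trans ih

theorem tendsto_cbinom_natCast {w : ℂ} (hw : -1 < w.re) :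
    Filter.Tendsto (fun k : ℕ => cbinom w k) Filter.atTop (nhds 0) := by
  obtain ⟨s, hs, hs'⟩ := exists_between (show (0 : ℝ) < min 1 (w.re + 1) from
    lt_min one_pos (by linarith))
  rw [lt_min_iff] at hs'
  obtain ⟨C, hC⟩ := exists_norm_cbinom_natCast_le hs.le hs'.1.le hs'.2
  have h : Filter.Tendsto (fun k : ℕ => C * ((k : ℝ) + 1) ^ (-s)) Filter.atTop (nhds (C * 0)) :=
    ((tendsto_rpow_neg_atTop hs).comp (Filter.tendsto_atTop_add_const_right _ 1
      tendsto_natCast_atTop_atTop)).const_mul C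
  rw [mul_zero] at h
  refine squeeze_zero_norm (fun k => ?_) h
  rw [Real.rpow_neg (by positivity), ← div_eq_mul_inv, le_div_iff₀ (by positivity)]
  exact hC k

/-- Some power of the sequence of binomial coefficients is summable. -/
theorem exists_holderConjugate_summable_cbinom {w : ℂ} (hw : -1 < w.re) :
    ∃ p q : ℝ, p.HolderConjugate q ∧ Summable fun k : ℕ => ‖cbinom w k‖ ^ p := by
  obtain ⟨s, hs, hs'⟩ := exists_between (show (0 : ℝ) < min 1 (w.re + 1) from
    lt_min one_pos (by linarith))
  rw [lt_min_iff] at hs'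
  obtain ⟨C, hC⟩ := exists_norm_cbinom_natCast_le hs.le hs'.1.le hs'.2
  have hp : 1 < 2 / s := by rw [lt_div_iff₀ hs]; linarith
  refine ⟨2 / s, (2 / s).conjExponent, Real.HolderConjugate.conjExponent hp, ?_⟩
  have hsum : Summable fun k : ℕ => C ^ (2 / s) * (1 / |(k : ℝ) + 1| ^ (2 : ℝ)) :=
    ((Real.summable_one_div_nat_add_rpow 1 2).2 (by norm_num)).mul_left _
  refine hsum.of_nonneg_of_le (fun k => by positivity) fun k => ?_
  have hk0 : (0 : ℝ) < k + 1 := by positivity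
  have h := Real.rpow_le_rpow (by positivity) (hC k) (show 0 ≤ 2 / s by positivity)
  rw [Real.mul_rpow (by positivity) (by positivity), ← Real.rpow_mul hk0.le,
    mul_div_cancel₀ _ hs.ne'] at h
  rw [abs_of_pos hk0, mul_one_div, le_div_iff₀ (by positivity)]
  exact h

theorem abs_sinc_pi_mul_le (y : ℝ) : |Real.sinc (π * y)| ≤ 2 / (1 + |y|) := by
  rw [le_div_iff₀ (by positivity)]
  rcases le_total |y| 1 with h | h
  · have := Real.abs_sinc_le_one (π * y)
    nlinarith [abs_nonneg (Real.sinc (π * y))]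
  · have hy : y ≠ 0 := by rintro rfl; simp at h; linarith
    have hy' : 0 < |y| := abs_pos.2 hy
    rw [Real.sinc_of_ne_zero (mul_ne_zero Real.pi_ne_zero hy), abs_div, abs_mul,
      abs_of_pos Real.pi_pos, div_mul_eq_mul_div, div_le_iff₀ (by positivity)]
    nlinarith [Real.abs_sin_le_one (π * y), Real.pi_gt_three, abs_nonneg (Real.sin (π * y))]

/-- The integer translates of `sinc` have `ℓ^q` norms bounded uniformly in the base point. -/
theorem exists_sum_abs_sinc_rpow_le {q : ℝ} (hq : 1 < q) :
    ∃ C, ∀ (x : ℝ) (s : Finset ℕ), ∑ k ∈ s, |Real.sinc (π * (x - k))| ^ q ≤ C := by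
  set F : ℤ → ℝ := fun j => (4 / (1 + |(j : ℝ)|)) ^ q with hF
  have hF0 : ∀ j, 0 ≤ F j := fun j => by positivity
  have hsum : Summable F := by
    have h := ((Real.summable_one_div_int_add_rpow 0 q).2 hq).mul_left (4 ^ q : ℝ)
    rw [← Set.Finite.summable_compl_iff (Set.finite_singleton (0 : ℤ))] at h ⊢
    refine h.of_nonneg_of_le (fun j => hF0 _) ?_
    rintro ⟨j, hj⟩
    have hj' : (j : ℝ) ≠ 0 := by simpa using hj
    have hj0 : 0 < |(j : ℝ)| := abs_pos.2 hj'
    simp only [hF, Function.comp_apply, add_zero]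
    rw [Real.div_rpow (by norm_num) (by positivity), mul_one_div]
    gcongr
    linarith
  refine ⟨∑' j, F j, fun x s => ?_⟩
  have hinj : Function.Injective fun k : ℕ => round x - (k : ℤ) := fun a b h => by
    simpa using h
  calc ∑ k ∈ s, |Real.sinc (π * (x - k))| ^ q
      ≤ ∑ k ∈ s, F (round x - (k : ℤ)) := by
        refine Finset.sum_le_sum fun k _ => ?_
        refine Real.rpow_le_rpow (abs_nonneg _) ((abs_sinc_pi_mul_le _).trans ?_) (by linarith)
        rw [div_le_div_iff₀ (by positivity) (by positivity)]
        have h₁ := abs_sub_round x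
        have h₂ : |((round x - (k : ℤ) : ℤ) : ℝ)| ≤ |x - k| + |x - round x| := by
          push_cast
          calc |(round x : ℝ) - k| = |(x - k) - (x - round x)| := by ring_nf
            _ ≤ _ := abs_sub _ _
        linarith [abs_nonneg (x - k)]
    _ = ∑ j ∈ s.map ⟨_, hinj⟩, F j := by simp
    _ ≤ ∑' j, F j := hsum.sum_le_tsum _ fun j _ => hF0 j

/-- The cardinal series of the binomial coefficients converges absolutely, uniformly on `ℝ`. -/
theorem exists_sum_norm_cbinom_mul_sinc_le {w : ℂ} (hw : -1 < w.re) :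
    ∃ C, ∀ (x : ℝ) (s : Finset ℕ),
      ∑ k ∈ s, ‖cbinom w k‖ * |Real.sinc (π * (x - k))| ≤ C := by
  obtain ⟨p, q, hpq, hp⟩ := exists_holderConjugate_summable_cbinom hw
  obtain ⟨C, hC⟩ := exists_sum_abs_sinc_rpow_le hpq.symm.lt
  have hp0 := hpq.pos
  have hq0 := hpq.symm.pos
  refine ⟨(∑' k : ℕ, ‖cbinom w k‖ ^ p) / p + C / q, fun x s => ?_⟩
  calc ∑ k ∈ s, ‖cbinom w k‖ * |Real.sinc (π * (x - k))|
      ≤ ∑ k ∈ s, (‖cbinom w k‖ ^ p / p + |Real.sinc (π * (x - k))| ^ q / q) :=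
        Finset.sum_le_sum fun k _ =>
          Real.young_inequality_of_nonneg (norm_nonneg _) (abs_nonneg _) hpq
    _ = (∑ k ∈ s, ‖cbinom w k‖ ^ p) / p + (∑ k ∈ s, |Real.sinc (π * (x - k))| ^ q) / q := by
        rw [Finset.sum_add_distrib, Finset.sum_div, Finset.sum_div]
    _ ≤ _ := by
        gcongr
        · exact hp.sum_le_tsum _ fun k _ => by positivity
        · exact hC x s

theorem integral_exp_two_pi_mul_I (y : ℝ) :
    ∫ ξ in (-(1 : ℝ) / 2)..(1 / 2), Complex.exp (2 * π * Complex.I * y * ξ) =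
      Real.sinc (π * y) := by
  rcases eq_or_ne y 0 with rfl | hy
  · simp; norm_num
  · have hc : 2 * π * Complex.I * y ≠ 0 := by
      simp [Real.pi_ne_zero, hy]
    have hy' : (y : ℂ) ≠ 0 := by exact_mod_cast hy
    have hπ : (π : ℂ) ≠ 0 := by exact_mod_cast Real.pi_ne_zero
    rw [integral_exp_mul_complex hc, Real.sinc_of_ne_zero (mul_ne_zero Real.pi_ne_zero hy)]
    push_cast
    rw [Complex.sin, show 2 * π * Complex.I * y * (1 / 2) = π * y * Complex.I by ring,
      show 2 * π * Complex.I * y * (-1 / 2) = -(π * y) * Complex.I by ring]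
    field_simp
    linear_combination (Complex.exp (π * y * Complex.I) -
      Complex.exp (-(π * y * Complex.I))) * Complex.I_sq

theorem integral_fourier_mul_exp {f : ℝ → ℂ} (hf : Integrable f) (k : ℕ) :
    ∫ ξ in (-(1 : ℝ) / 2)..(1 / 2), 𝓕 f ξ * Complex.exp (2 * π * Complex.I * ξ * k) =
      ∫ x : ℝ, f x * Real.sinc (π * (x - k)) := by
  have hab : (-(1 : ℝ) / 2) ≤ 1 / 2 := by norm_num
  have hg : IntervalIntegrable (fun ξ : ℝ => Complex.exp (2 * π * Complex.I * ξ * k)) volume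
      (-(1 : ℝ) / 2) (1 / 2) := Continuous.intervalIntegrable (by fun_prop) _ _
  rw [intervalIntegrable_iff_integrableOn_Ioc_of_le hab] at hg
  rw [intervalIntegral.integral_of_le hab]
  refine (VectorFourier.integral_fourierIntegral_smul_eq_flip (L := innerₗ ℝ) (F := ℂ)
    Real.continuous_fourierChar continuous_inner hf hg).trans ?_
  refine integral_congr_ae (.of_forall fun x => ?_)
  simp only [smul_eq_mul]
  congr 1
  rw [Real.vector_fourierIntegral_eq_integral_exp_smul, ← intervalIntegral.integral_of_le hab,
    show π * (x - k) = π * (k - x) * (-1) by ring, mul_neg_one, Real.sinc_neg,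
    ← integral_exp_two_pi_mul_I]
  refine intervalIntegral.integral_congr fun ξ _ => ?_
  simp only [smul_eq_mul, ← Complex.exp_add]
  congr 1
  simp
  ring

theorem integral_mul_eq_of_hasSum_sinc {b : ℕ → ℂ} {g : ℝ → ℂ} {f : ℝ → ℂ} (hf : Integrable f)
    {C : ℝ} (hC : ∀ (x : ℝ) (s : Finset ℕ), ∑ k ∈ s, ‖b k‖ * |Real.sinc (π * (x - k))| ≤ C)
    (hg : ∀ x : ℝ, HasSum (fun k : ℕ => b k * Real.sinc (π * (x - k))) (g x)) :
    HasSum (fun k : ℕ => b k *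
      ∫ ξ in (-(1 : ℝ) / 2)..(1 / 2), 𝓕 f ξ * Complex.exp (2 * π * Complex.I * ξ * k))
      (∫ x : ℝ, g x * f x) := by
  set F : ℕ → ℝ → ℂ := fun k x => b k * (f x * Real.sinc (π * (x - k))) with hF
  have hint : ∀ k, Integrable (F k) := fun k => by
    refine (hf.mul_bdd (c := 1) ?_ (.of_forall fun x => ?_)).const_mul _
    · exact (Complex.continuous_ofReal.comp
        (Real.continuous_sinc.comp (by fun_prop))).aestronglyMeasurable
    · simpa using Real.abs_sinc_le_one _
  have hsum : Summable fun k => ∫ x, ‖F k x‖ := by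
    refine summable_of_sum_le (c := C * ∫ x, ‖f x‖) (fun k => by positivity) fun s => ?_
    rw [← integral_finsetSum _ fun k _ => (hint k).norm, ← integral_const_mul]
    refine integral_mono (integrable_finsetSum _ fun k _ => (hint k).norm)
      (hf.norm.const_mul C) fun x => ?_
    calc ∑ k ∈ s, ‖F k x‖ = (∑ k ∈ s, ‖b k‖ * |Real.sinc (π * (x - k))|) * ‖f x‖ := by
          rw [Finset.sum_mul]
          refine Finset.sum_congr rfl fun k _ => ?_
          simp [hF]; ring
      _ ≤ C * ‖f x‖ := by gcongr; exact hC x s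
  convert! hasSum_integral_of_summable_integral_norm hint hsum using 1
  · funext k
    rw [integral_fourier_mul_exp hf, integral_const_mul]
  · congr 1 with x
    rw [← (hg x).tsum_eq, ← tsum_mul_right]
    exact tsum_congr fun k => by simp only [hF]; ring

theorem summable_norm_cbinom_div {w : ℂ} (hw : -1 < w.re) (a : ℝ) :
    Summable fun k : ℕ => ‖cbinom w k‖ * (1 / |(k : ℝ) + a|) := by
  obtain ⟨p, q, hpq, hp⟩ := exists_holderConjugate_summable_cbinom hw
  have hq := (Real.summable_one_div_nat_add_rpow a q).2 hpq.symm.lt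
  refine ((hp.div_const p).add (hq.div_const q)).of_nonneg_of_le (fun k => by positivity)
    fun k => ?_
  refine (Real.young_inequality_of_nonneg (norm_nonneg _) (by positivity) hpq).trans_eq ?_
  rw [Real.div_rpow zero_le_one (abs_nonneg _), Real.one_rpow]

theorem summable_cbinom_div {w : ℂ} (hw : -1 < w.re) (a : ℝ) :
    Summable fun k : ℕ => (-1) ^ k * cbinom w k / ((a : ℂ) + k) := by
  refine (summable_norm_cbinom_div hw a).of_norm_bounded fun k => le_of_eq ?_
  have : ‖(a : ℂ) + k‖ = |(k : ℝ) + a| := by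
    rw [← Complex.ofReal_natCast, ← Complex.ofReal_add, Complex.norm_real, Real.norm_eq_abs,
      add_comm]
  simp [this, div_eq_mul_inv]

theorem hasSum_cbinom_mul_pow {w : ℂ} (hw : -1 < w.re) {t : ℝ} (ht₀ : 0 ≤ t) (ht₁ : t < 1) :
    HasSum (fun k : ℕ => (-1) ^ k * cbinom w k * (t : ℂ) ^ k) ((1 - t : ℂ) ^ w) := by
  have h := (Complex.one_add_cpow_hasFPowerSeriesOnBall_zero (a := w)).hasSum (y := -(t : ℂ))
    (by simpa [enorm_eq_nnnorm, ← NNReal.coe_lt_coe, abs_of_nonneg ht₀] using ht₁)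
  convert! h using 1
  · funext k
    simp only [binomialSeries_apply, List.ofFn_const, List.prod_replicate, smul_eq_mul]
    rw [cbinom_natCast_eq_choose hw, neg_pow]
    ring
  · simp [sub_eq_add_neg]

theorem hasSum_cbinom_div_of_pos {w : ℂ} (hw : -1 < w.re) {a : ℝ} (ha : 0 < a) :
    HasSum (fun k : ℕ => (-1) ^ k * cbinom w k / ((a : ℂ) + k))
      (Complex.Gamma a * Complex.Gamma (w + 1) / Complex.Gamma (a + w + 1)) := by
  set F : ℕ → ℝ → ℂ := fun k t => (-1) ^ k * cbinom w k * ((t ^ (a - 1 + k) : ℝ) : ℂ) with hF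
  have hr : ∀ k : ℕ, -1 < a - 1 + k := fun k => by
    have : (0 : ℝ) ≤ k := k.cast_nonneg
    linarith
  have hpow : ∀ k : ℕ, IntegrableOn (fun t : ℝ => t ^ (a - 1 + k)) (Set.Ioc 0 1) := fun k =>
    (intervalIntegrable_iff_integrableOn_Ioc_of_le zero_le_one).1
      (intervalIntegral.intervalIntegrable_rpow' (hr k))
  have hval : ∀ k : ℕ, ∫ t in Set.Ioc (0 : ℝ) 1, t ^ (a - 1 + k) = 1 / (a + k) := fun k => by
    have hk : a + k ≠ 0 := by positivity
    rw [← intervalIntegral.integral_of_le zero_le_one, integral_rpow (.inl (hr k)),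
      show a - 1 + k + 1 = a + k by ring]
    simp [Real.zero_rpow hk]
  have hint : ∀ k, IntegrableOn (F k) (Set.Ioc 0 1) := fun k => (hpow k).ofReal.const_mul _
  have hsum : Summable fun k => ∫ t in Set.Ioc (0 : ℝ) 1, ‖F k t‖ := by
    refine (summable_norm_cbinom_div hw a).congr fun k => ?_
    have hk : 0 < (k : ℝ) + a := by positivity
    rw [abs_of_pos hk, add_comm, ← hval, ← integral_const_mul]
    refine setIntegral_congr_fun measurableSet_Ioc fun t ht => ?_
    simp [hF, abs_of_nonneg (Real.rpow_nonneg ht.1.le _)]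
  convert! hasSum_integral_of_summable_integral_norm hint hsum using 1
  · funext k
    rw [integral_const_mul, integral_complex_ofReal, hval]
    push_cast
    ring
  · rw [add_assoc, ← Complex.betaIntegral_eq_Gamma_mul_div _ _ (by simpa) (by simp; linarith),
      Complex.betaIntegral, intervalIntegral.integral_of_le zero_le_one,
      integral_Ioc_eq_integral_Ioo, integral_Ioc_eq_integral_Ioo]
    refine setIntegral_congr_fun measurableSet_Ioo fun t ht => ?_
    have h := (hasSum_cbinom_mul_pow hw ht.1.le ht.2).mul_left ((t : ℂ) ^ ((a : ℂ) - 1))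
    simp only [add_sub_cancel_right]
    rw [← h.tsum_eq]
    refine tsum_congr fun k => ?_
    simp only [hF]
    rw [Real.rpow_add ht.1, Real.rpow_natCast]
    push_cast [Complex.ofReal_cpow ht.1.le]
    ring

/-- Partial fraction expansion of the Beta function in its first argument. -/
theorem hasSum_cbinom_div {w : ℂ} (hw : -1 < w.re) {a : ℝ} (ha : ∀ n : ℕ, a + n ≠ 0) :
    HasSum (fun k : ℕ => (-1) ^ k * cbinom w k / ((a : ℂ) + k))
      (Complex.Gamma a * Complex.Gamma (w + 1) / Complex.Gamma (a + w + 1)) := by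
  obtain ⟨n, hn⟩ := exists_nat_gt (-a)
  induction n generalizing a with
  | zero => exact hasSum_cbinom_div_of_pos hw (by simpa using hn)
  | succ n ih =>
    have h := ih (a := a + 1) (fun m => by
      have := ha (m + 1)
      push_cast at this
      rwa [add_assoc, add_comm 1]) (by push_cast at hn; linarith)
    have hS := (summable_cbinom_div hw a).hasSum
    convert hS using 1
    set S := ∑' k : ℕ, (-1) ^ k * cbinom w k / ((a : ℂ) + k)
    have hac : ∀ m : ℕ, (a : ℂ) + m ≠ 0 := fun m => by exact_mod_cast ha m
    have ha0 : (a : ℂ) ≠ 0 := by simpa using hac 0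
    have range_sum_identity : ∀ m : ℕ,
        a * ∑ k ∈ Finset.range (m + 1), (-1) ^ k * cbinom w k / ((a : ℂ) + k) -
          (a + w + 1) * ∑ k ∈ Finset.range m, (-1) ^ k * cbinom w k / (((a + 1 : ℝ) : ℂ) + k) =
        (-1) ^ m * cbinom w m := by
      intro m
      induction m with
      | zero => simp; field_simp
      | succ m ihm =>
        rw [Finset.sum_range_succ _ (m + 1),
          Finset.sum_range_succ (fun k : ℕ => (-1) ^ k * cbinom w k / (((a + 1 : ℝ) : ℂ) + k)) m]
        have h₁ := hac (m + 1)
        have h₂ := cbinom_succ_mul w m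
        push_cast at h₁ h₂ ⊢
        have e : (a : ℂ) + 1 + m = a + (m + 1) := by ring
        push_cast at ihm
        rw [mul_add, mul_add, add_sub_add_comm, ihm, e]
        field_simp
        linear_combination (-1) ^ m * h₂
    have hlim := ((hS.tendsto_sum_nat.comp (Filter.tendsto_add_atTop_nat 1)).const_mul
      (a : ℂ)).sub (h.tendsto_sum_nat.const_mul ((a : ℂ) + w + 1))
    have hzero : Filter.Tendsto (fun m : ℕ => (-1) ^ m * cbinom w m) Filter.atTop (nhds 0) := by
      rw [tendsto_zero_iff_norm_tendsto_zero]
      simpa using (tendsto_cbinom_natCast hw).norm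
    have key := tendsto_nhds_unique (hlim.congr range_sum_identity) hzero
    have hG := Complex.one_div_Gamma_eq_self_mul_one_div_Gamma_add_one (a + w + 1)
    have e : ((a + 1 : ℝ) : ℂ) + w + 1 = a + w + 1 + 1 := by push_cast; ring
    rw [e] at key
    push_cast at key
    rw [Complex.Gamma_add_one _ ha0] at key
    apply mul_left_cancel₀ ha0
    rw [div_eq_mul_inv, hG]
    linear_combination -key

theorem sinc_pi_mul_intCast {n : ℤ} (hn : n ≠ 0) : Real.sinc (π * n) = 0 := by
  rw [Real.sinc_of_ne_zero (mul_ne_zero Real.pi_ne_zero (Int.cast_ne_zero.2 hn)), mul_comm,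
    Real.sin_int_mul_pi, zero_div]

/-- The binomial coefficient is the sum of its cardinal series. -/
theorem hasSum_cbinom_mul_sinc {w : ℂ} (hw : -1 < w.re) (x : ℝ) :
    HasSum (fun k : ℕ => cbinom w k * Real.sinc (π * (x - k))) (cbinom w x) := by
  by_cases hx : ∃ n : ℤ, x = n
  · obtain ⟨n, rfl⟩ := hx
    have hz : ∀ k : ℕ, (k : ℤ) ≠ n → Real.sinc (π * ((n : ℝ) - k)) = 0 := fun k hk => by
      have := sinc_pi_mul_intCast (sub_ne_zero.2 hk.symm)
      exact_mod_cast this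
    rcases lt_or_ge n 0 with hn | hn
    · have h0 : cbinom w ((n : ℝ) : ℂ) = 0 := by
        obtain ⟨m, rfl⟩ : ∃ m : ℕ, n = -m - 1 := ⟨(-n - 1).toNat, by omega⟩
        simp [cbinom, Complex.Gamma_neg_nat_eq_zero]
      rw [h0]
      convert! hasSum_zero using 2 with k
      rw [hz k (by omega)]
      simp
    · lift n to ℕ using hn
      convert hasSum_single n fun k hk => ?_ using 1
      · simp
      · rw [hz k (by exact_mod_cast hk)]
        simp
  · push Not at hx
    have ha : ∀ n : ℕ, -x + n ≠ 0 := fun n h => hx n (by push_cast; linarith)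
    have hs : Complex.sin (π * x) ≠ 0 := by
      rw [Complex.sin_ne_zero_iff]
      intro n h
      refine hx n ?_
      have : (x : ℂ) = n := mul_left_cancel₀ (Complex.ofReal_ne_zero.2 Real.pi_ne_zero)
        (by rw [h, mul_comm])
      exact_mod_cast this
    have hπ : (π : ℂ) ≠ 0 := Complex.ofReal_ne_zero.2 Real.pi_ne_zero
    convert! (hasSum_cbinom_div hw ha).mul_left (-Complex.sin (π * x) / π) using 1
    · funext k
      have hk : x - k ≠ 0 := sub_ne_zero.2 (hx k)
      have hk' : (x : ℂ) - k ≠ 0 := by exact_mod_cast hk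
      have hk'' : -(x : ℂ) + k ≠ 0 := by rw [neg_add_eq_sub, ← neg_sub]; exact neg_ne_zero.2 hk'
      rw [Real.sinc_of_ne_zero (mul_ne_zero Real.pi_ne_zero hk), mul_sub, mul_comm π (k : ℝ),
        Real.sin_sub_nat_mul_pi]
      push_cast
      rw [show (π : ℂ) * x - k * π = -(π * (-(x : ℂ) + k)) by ring]
      field_simp
    · have h := Complex.Gamma_mul_Gamma_one_sub (-x)
      have hΓ : Complex.Gamma (x + 1) ≠ 0 := Complex.Gamma_ne_zero fun m hm => by
        refine hx (-m - 1) ?_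
        have : (x : ℂ) = -m - 1 := by linear_combination hm
        exact_mod_cast this
      rw [sub_neg_eq_add, add_comm, mul_neg, Complex.sin_neg, div_neg] at h
      have h' : Complex.Gamma (-x) = -π / Complex.sin (π * x) / Complex.Gamma (x + 1) := by
        rw [eq_div_iff hΓ, h, neg_div]
      rw [Complex.ofReal_neg, h', cbinom, show w - x + 1 = -x + w + 1 by ring]
      generalize Complex.sin (π * x) = σ at hs
      field_simp

theorem integral_binom_mul_eq_series (w : ℂ) (hw : -1 < w.re) (f : ℝ → ℂ)
    (hf : Integrable f) :
    ∫ x : ℝ, cbinom w (x : ℂ) * f x =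
      ∑' k : ℕ, cbinom w (k : ℂ) *
        ∫ ξ in (-(1 : ℝ)/2)..(1/2), 𝓕 f ξ * Complex.exp (2 * π * Complex.I * ξ * k) := by
  obtain ⟨C, hC⟩ := exists_sum_norm_cbinom_mul_sinc_le hw
  exact (integral_mul_eq_of_hasSum_sinc hf hC (hasSum_cbinom_mul_sinc hw)).tsum_eq.symm
end

section
/- Let w be a complex number with Re(w) > −1 and let α be a complex number with Re(α) > 0. Then ∫_{−∞}^{∞} binom(w, x) / (x² + α²) dx = Σ_{k=0}^{∞} binom(w, k) / (k² + α²) − (π / (α(e^{2πα} − 1))) · (binom(w, iα) + binom(w, −iα)). -/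
open scoped Real
open MeasureTheory

open Complex Set Filter Topology

section CircleBase

variable {r θ : ℝ}

theorem one_add_mul_exp_re (r θ : ℝ) : (1 + r * exp (θ * I)).re = 1 + r * Real.cos θ := by
  simp [exp_ofReal_mul_I_re, exp_ofReal_mul_I_im]

theorem one_add_mul_exp_im (r θ : ℝ) : (1 + r * exp (θ * I)).im = r * Real.sin θ := by
  simp [exp_ofReal_mul_I_re, exp_ofReal_mul_I_im]

theorem one_add_mul_exp_re_pos (hr : r ∈ Icc (0 : ℝ) 1) (hθ : θ ∈ Ioo (-π) π) :
    0 < (1 + r * exp (θ * I)).re := by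
  rw [one_add_mul_exp_re]
  have hk : 0 < Real.cos (θ / 2) :=
    Real.cos_pos_of_mem_Ioo ⟨by linarith [hθ.1], by linarith [hθ.2]⟩
  have hc : Real.cos θ = 2 * Real.cos (θ / 2) ^ 2 - 1 := by
    rw [← Real.cos_two_mul]; ring_nf
  have : -1 < Real.cos θ := by rw [hc]; nlinarith
  nlinarith [hr.1, hr.2, Real.cos_le_one θ]

theorem one_add_mul_exp_re_pos_of_lt (hr : r ∈ Ico (0 : ℝ) 1) :
    0 < (1 + r * exp (θ * I)).re := by
  rw [one_add_mul_exp_re]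
  nlinarith [hr.1, hr.2, Real.neg_one_le_cos θ]

theorem norm_one_add_mul_exp_le (hr : r ∈ Icc (0 : ℝ) 1) : ‖1 + r * exp (θ * I)‖ ≤ 2 := by
  refine (norm_add_le _ _).trans ?_
  rw [norm_mul, norm_exp_ofReal_mul_I, norm_real, Real.norm_of_nonneg hr.1, norm_one]
  linarith [hr.2]

theorem one_sub_abs_div_pi_le_norm (hr : r ∈ Icc (0 : ℝ) 1) (hθ : θ ∈ Ioo (-π) π) :
    1 - |θ| / π ≤ ‖1 + r * exp (θ * I)‖ := by
  have hπ := Real.pi_pos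
  have habs : |θ| < π := abs_lt.2 hθ
  have hk : 1 - |θ| / π ≤ Real.cos (θ / 2) := by
    have := Real.one_sub_mul_le_cos (x := |θ| / 2) (by positivity) (by linarith)
    rw [show |θ| / 2 = |θ / 2| by rw [abs_div, abs_two], Real.cos_abs] at this
    convert this using 2
    rw [abs_div, abs_two]; field_simp
  refine hk.trans (Real.le_sqrt_of_sq_le ?_ |>.trans_eq (norm_def _).symm)
  rw [normSq_apply, one_add_mul_exp_re, one_add_mul_exp_im]
  set k := Real.cos (θ / 2)
  have hc : Real.cos θ = 2 * k ^ 2 - 1 := by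
    rw [← Real.cos_two_mul]; ring_nf
  have hs := Real.sin_sq_add_cos_sq θ
  have hk1 : k ^ 2 ≤ 1 := Real.cos_sq_le_one _
  have h1 : (1 + r * Real.cos θ) * (1 + r * Real.cos θ) + r * Real.sin θ * (r * Real.sin θ)
      = 1 + 2 * r * Real.cos θ + r ^ 2 := by linear_combination r ^ 2 * hs
  rw [h1, hc]
  have h2 : 0 ≤ (1 - k ^ 2) * (1 - r) ^ 2 := mul_nonneg (by linarith) (sq_nonneg _)
  have h3 : 0 ≤ k ^ 2 * (r * (2 + r)) :=
    mul_nonneg (sq_nonneg _) (mul_nonneg hr.1 (by linarith [hr.1]))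
  nlinarith

theorem norm_cpow_le_rpow_mul_exp {p : ℂ} (hp : p ≠ 0) (w : ℂ) :
    ‖p ^ w‖ ≤ ‖p‖ ^ w.re * Real.exp (π * |w.im|) := by
  rw [norm_cpow_of_ne_zero hp, div_eq_mul_inv, ← Real.exp_neg]
  gcongr
  calc -(arg p * w.im) ≤ |arg p * w.im| := neg_le_abs _
    _ = |arg p| * |w.im| := abs_mul _ _
    _ ≤ π * |w.im| := by gcongr; exact abs_arg_le_pi p

/-- For `Re w > -1` the powers `(1 + r e^{iθ}) ^ w` are dominated, uniformly in `r ∈ [0, 1]`, by an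
integrable function of `θ`. -/
theorem exists_bound_one_add_mul_exp_cpow {w : ℂ} (hw : -1 < w.re) :
    ∃ g : ℝ → ℝ, IntervalIntegrable g volume (-π) π ∧
      ∀ r ∈ Icc (0 : ℝ) 1, ∀ θ ∈ Ioo (-π) π, ‖(1 + r * exp (θ * I)) ^ w‖ ≤ g θ := by
  have hπ := Real.pi_pos
  rcases le_or_gt 0 w.re with h0 | h0
  · refine ⟨fun _ => 2 ^ w.re * Real.exp (π * |w.im|), intervalIntegrable_const,
      fun r hr θ hθ => ?_⟩
    have hre := one_add_mul_exp_re_pos hr hθ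
    refine (norm_cpow_le_rpow_mul_exp (fun h => by simp [h] at hre) w).trans ?_
    beta_reduce
    gcongr
    exact norm_one_add_mul_exp_le hr
  · refine ⟨fun θ => ((1 - θ / π) ^ w.re + (1 + θ / π) ^ w.re) * Real.exp (π * |w.im|),
      ?_, fun r hr θ hθ => ?_⟩
    · have h := intervalIntegral.intervalIntegrable_rpow' (a := 0) (b := 2) hw
      refine IntervalIntegrable.mul_const (IntervalIntegrable.add ?_ ?_) _
      · have := (h.comp_sub_left 1).comp_mul_left (c := π⁻¹)
        simp only [sub_zero] at this
        convert this.symm using 2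
        · rw [div_eq_inv_mul]
        · field_simp; norm_num
        · field_simp
      · have := (h.comp_add_left 1).comp_mul_left (c := π⁻¹)
        convert this using 2
        · rw [div_eq_inv_mul]
        · field_simp; norm_num
        · field_simp; norm_num
    · have hre := one_add_mul_exp_re_pos hr hθ
      refine (norm_cpow_le_rpow_mul_exp (fun h => by simp [h] at hre) w).trans ?_
      beta_reduce
      gcongr
      have habs : |θ| < π := abs_lt.2 hθ
      have hpos : 0 < 1 - |θ| / π := by rw [sub_pos, div_lt_one hπ]; exact habs
      refine (Real.rpow_le_rpow_of_nonpos hpos (one_sub_abs_div_pi_le_norm hr hθ) h0.le).trans ?_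
      have h1 : 0 ≤ 1 - θ / π := by rw [sub_nonneg, div_le_one hπ]; exact hθ.2.le
      have h2 : 0 ≤ 1 + θ / π := by
        have := hθ.1
        rw [← sub_nonneg] at *
        field_simp; linarith
      rcases abs_cases θ with ⟨h, -⟩ | ⟨h, -⟩ <;> rw [h]
      · linarith [Real.rpow_nonneg h2 w.re]
      · rw [neg_div, sub_neg_eq_add]; linarith [Real.rpow_nonneg h1 w.re]

end CircleBase

/-- The integral of `(1 + u) ^ w u ^ (-z)` with respect to the angle over the circle `|u| = r` cut
along the negative axis, the factor `r ^ (-z)` being left out. -/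
noncomputable def circleCpowIntegral (w z : ℂ) (r : ℝ) : ℂ :=
  ∫ θ in -π..π, (1 + r * exp (θ * I)) ^ w * exp (-(θ * I * z))

section CircleIntegral

variable {w : ℂ}

theorem measurable_one_add_mul_exp_cpow (w : ℂ) (r : ℝ) :
    Measurable fun θ : ℝ => (1 + r * exp (θ * I)) ^ w := by
  apply Measurable.pow_const
  fun_prop

theorem norm_exp_neg_mul_I_mul_le {θ : ℝ} (hθ : |θ| ≤ π) (z : ℂ) :
    ‖exp (-(θ * I * z))‖ ≤ Real.exp (π * ‖z‖) := by
  refine (norm_exp_le_exp_norm _).trans ?_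
  rw [norm_neg, norm_mul, norm_mul, norm_I, mul_one, norm_real, Real.norm_eq_abs]
  gcongr

theorem ae_mem_uIoc_neg_pi_pi {p : ℝ → Prop} (h : ∀ θ ∈ Ioo (-π) π, p θ) :
    ∀ᵐ θ : ℝ, θ ∈ uIoc (-π) π → p θ := by
  filter_upwards [Measure.ae_ne volume π] with θ hne hθ
  rw [uIoc_of_le (by linarith [Real.pi_pos])] at hθ
  exact h θ ⟨hθ.1, lt_of_le_of_ne hθ.2 hne⟩

theorem exists_bound_one_add_mul_exp_cpow_mul_exp (hw : -1 < w.re) (R : ℝ) :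
    ∃ g : ℝ → ℝ, IntervalIntegrable g volume (-π) π ∧
      ∀ r ∈ Icc (0 : ℝ) 1, ∀ θ ∈ Ioo (-π) π, ∀ z : ℂ, ‖z‖ ≤ R →
        ‖(1 + r * exp (θ * I)) ^ w * exp (-(θ * I * z))‖ ≤ g θ := by
  obtain ⟨g, hg, hb⟩ := exists_bound_one_add_mul_exp_cpow hw
  refine ⟨fun θ => g θ * Real.exp (π * R), hg.mul_const _, fun r hr θ hθ z hz => ?_⟩
  rw [norm_mul]
  have h2 := norm_exp_neg_mul_I_mul_le (abs_lt.2 hθ).le z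
  have h1 := hb r hr θ hθ
  have h3 : Real.exp (π * ‖z‖) ≤ Real.exp (π * R) := by
    gcongr
  exact mul_le_mul h1 (h2.trans h3) (norm_nonneg _) ((norm_nonneg _).trans h1)

theorem intervalIntegrable_one_add_mul_exp_cpow_mul_exp (hw : -1 < w.re) (z : ℂ) {r : ℝ}
    (hr : r ∈ Icc (0 : ℝ) 1) :
    IntervalIntegrable (fun θ : ℝ => (1 + r * exp (θ * I)) ^ w * exp (-(θ * I * z)))
      volume (-π) π := by
  obtain ⟨g, hg, hb⟩ := exists_bound_one_add_mul_exp_cpow_mul_exp hw ‖z‖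
  refine hg.mono_fun' ?_ ?_
  · exact ((measurable_one_add_mul_exp_cpow w r).mul (by fun_prop)).aestronglyMeasurable
  · rw [EventuallyLE, ae_restrict_iff' measurableSet_uIoc]
    exact ae_mem_uIoc_neg_pi_pi fun θ hθ => hb r hr θ hθ z le_rfl

theorem continuousOn_circleCpowIntegral (hw : -1 < w.re) (z : ℂ) :
    ContinuousOn (circleCpowIntegral w z) (Icc 0 1) := by
  intro r hr
  obtain ⟨g, hg, hb⟩ := exists_bound_one_add_mul_exp_cpow_mul_exp hw ‖z‖
  refine intervalIntegral.continuousWithinAt_of_dominated_interval (bound := g) ?_ ?_ hg ?_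
  · exact .of_forall fun r =>
      ((measurable_one_add_mul_exp_cpow w r).mul (by fun_prop)).aestronglyMeasurable
  · filter_upwards [self_mem_nhdsWithin] with s hs
    exact ae_mem_uIoc_neg_pi_pi fun θ hθ => hb s hs θ hθ z le_rfl
  · refine ae_mem_uIoc_neg_pi_pi fun θ hθ => ContinuousAt.continuousWithinAt ?_
    refine ContinuousAt.mul ?_ continuousAt_const
    refine ContinuousAt.cpow (by fun_prop) continuousAt_const ?_
    exact .inl (one_add_mul_exp_re_pos hr hθ)

theorem hasDerivAt_circleCpowIntegral (hw : -1 < w.re) (z : ℂ) {r : ℝ} (hr : r ∈ Ioo (0 : ℝ) 1) :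
    HasDerivAt (circleCpowIntegral w z)
      ((z * circleCpowIntegral w z r - 2 * sin (π * z) * (1 - r) ^ w) / r) r := by
  have hπ := Real.pi_pos
  set F' : ℝ → ℝ → ℂ := fun r θ =>
    w * (1 + r * exp (θ * I)) ^ (w - 1) * exp (θ * I) * exp (-(θ * I * z)) with hF'
  obtain ⟨ρ, hrρ, hρ⟩ := exists_between hr.2
  have hcont : ContinuousOn (fun p : ℝ × ℝ => F' p.1 p.2) (Icc 0 ρ ×ˢ Icc (-π) π) := by
    refine ContinuousOn.mul (ContinuousOn.mul (ContinuousOn.mul continuousOn_const ?_)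
      (by fun_prop)) (by fun_prop)
    refine ContinuousOn.cpow (by fun_prop) continuousOn_const ?_
    rintro ⟨s, θ⟩ ⟨hs, -⟩
    exact .inl (one_add_mul_exp_re_pos_of_lt ⟨hs.1, hs.2.trans_lt hρ⟩)
  obtain ⟨C, hC⟩ := (isCompact_Icc.prod isCompact_Icc).exists_bound_of_continuousOn hcont
  have hrI : r ∈ Icc (0 : ℝ) 1 := Ioo_subset_Icc_self hr
  obtain ⟨hint, hder⟩ := intervalIntegral.hasDerivAt_integral_of_dominated_loc_of_deriv_le
    (μ := volume) (a := -π) (b := π) (bound := fun _ => C)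
    (F := fun (r θ : ℝ) => (1 + r * exp (θ * I)) ^ w * exp (-(θ * I * z))) (F' := F')
    (Ioo_mem_nhds hr.1 hrρ)
    (.of_forall fun r =>
      ((measurable_one_add_mul_exp_cpow w r).mul (by fun_prop)).aestronglyMeasurable)
    (intervalIntegrable_one_add_mul_exp_cpow_mul_exp hw z hrI)
    ((((measurable_one_add_mul_exp_cpow (w - 1) r).const_mul w).mul (by fun_prop)).mul
      (by fun_prop)).aestronglyMeasurable
    (ae_mem_uIoc_neg_pi_pi fun θ hθ s hs =>
      hC (s, θ) ⟨Ioo_subset_Icc_self hs, Ioo_subset_Icc_self hθ⟩)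
    intervalIntegrable_const
    (ae_mem_uIoc_neg_pi_pi fun θ hθ s hs => by
      have hmem : (1 + s * exp (θ * I)) ∈ slitPlane :=
        .inl (one_add_mul_exp_re_pos_of_lt ⟨hs.1.le, hs.2.trans hρ⟩)
      have h1 : HasDerivAt (fun s : ℝ => 1 + (s : ℂ) * exp (θ * I)) (exp (θ * I)) s := by
        simpa using ((ofRealCLM.hasDerivAt (x := s)).mul_const (exp (θ * I))).const_add 1
      exact ((hasStrictDerivAt_cpow_const hmem).hasDerivAt.comp s h1).mul_const _)
  refine hder.congr_deriv ?_
  have hangle : ∀ θ ∈ uIcc (-π) π, HasDerivAt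
      (fun θ : ℝ => (1 + r * exp (θ * I)) ^ w * exp (-(θ * I * z)))
      (I * (r * F' r θ - z * ((1 + r * exp (θ * I)) ^ w * exp (-(θ * I * z))))) θ := by
    intro θ _
    have hmem : (1 + r * exp (θ * I)) ∈ slitPlane :=
      .inl (one_add_mul_exp_re_pos_of_lt ⟨hr.1.le, hr.2⟩)
    have h0 : HasDerivAt (fun θ : ℝ => (θ : ℂ) * I) I θ := by
      simpa using (ofRealCLM.hasDerivAt (x := θ)).mul_const I
    have h1 : HasDerivAt (fun θ : ℝ => 1 + (r : ℂ) * exp (θ * I)) (r * (exp (θ * I) * I)) θ :=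
      (h0.cexp.const_mul _).const_add 1
    have h2 := ((hasStrictDerivAt_cpow_const (c := w) hmem).hasDerivAt.comp θ h1).mul (h0.mul_const z).neg.cexp
    convert! h2 using 1
    simp only [hF', Pi.neg_apply, Function.comp_apply]
    ring
  have hint1 := intervalIntegrable_one_add_mul_exp_cpow_mul_exp hw z hrI
  have hftc := intervalIntegral.integral_eq_sub_of_hasDerivAt hangle
    (((hint.const_mul _).sub (hint1.const_mul _)).const_mul _)
  rw [intervalIntegral.integral_const_mul,
    intervalIntegral.integral_sub (hint.const_mul _) (hint1.const_mul _),
    intervalIntegral.integral_const_mul, intervalIntegral.integral_const_mul] at hftc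
  rw [show ((-π : ℝ) : ℂ) = -(π : ℂ) by push_cast; rfl, exp_pi_mul_I, neg_mul, exp_neg_pi_mul_I,
    ← mul_sub] at hftc
  have hr0 : (r : ℂ) ≠ 0 := by exact_mod_cast hr.1.ne'
  have hsin : exp (-(π * I * z)) - exp (-(-(π * I) * z)) = -(2 * I * sin (π * z)) := by
    rw [sin]
    rw [show -(π * I * z) = -(π * z) * I by ring, show -(-(π * I) * z) = π * z * I by ring]
    linear_combination (exp (-(π * z) * I) - exp (π * z * I)) * I_sq
  rw [hsin] at hftc
  rw [eq_div_iff hr0, circleCpowIntegral]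
  rw [show (1 + r * -1 : ℂ) = 1 - r by ring] at hftc
  have := congrArg (I * ·) hftc
  simp only [← mul_assoc, I_mul_I] at this
  linear_combination -this + 2 * (1 - r : ℂ) ^ w * sin (π * z) * I_sq

end CircleIntegral

section Cauchy

variable {w : ℂ}

theorem circleCpowIntegral_one_eq_betaIntegral (hw : -1 < w.re) {z : ℂ} (hz : z.re < 0) :
    circleCpowIntegral w z 1 = -2 * sin (π * z) * betaIntegral (-z) (w + 1) := by
  have hz0 : -z ≠ 0 := fun h => by
    rw [neg_eq_zero] at h; simp [h] at hz
  have hder : ∀ r ∈ Ioo (0 : ℝ) 1,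
      HasDerivAt (fun r : ℝ => (r : ℂ) ^ (-z) * circleCpowIntegral w z r)
        (-2 * sin (π * z) * ((r : ℂ) ^ (-z - 1) * (1 - (r : ℂ)) ^ (w + 1 - 1))) r := by
    intro r hr
    have hr0 : (r : ℂ) ≠ 0 := by exact_mod_cast hr.1.ne'
    have h1 : HasDerivAt (fun r : ℝ => (r : ℂ) ^ (-z)) (-z * (r : ℂ) ^ (-z - 1)) r := by
      have := (hasStrictDerivAt_cpow_const (c := -z)
        (ofReal_mem_slitPlane.2 hr.1)).hasDerivAt.comp_ofReal
      exact this
    refine (h1.mul (hasDerivAt_circleCpowIntegral hw z hr)).congr_deriv ?_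
    rw [cpow_sub _ _ hr0, cpow_one, add_sub_cancel_right]
    field_simp
    ring
  have hint : IntervalIntegrable (fun r : ℝ =>
      -2 * sin (π * z) * ((r : ℂ) ^ (-z - 1) * (1 - (r : ℂ)) ^ (w + 1 - 1))) volume 0 1 :=
    (betaIntegral_convergent (by simpa using hz) (by simp; linarith)).const_mul _
  have hJ := continuousOn_circleCpowIntegral hw z
  have hpow : Continuous fun r : ℝ => (r : ℂ) ^ (-z) :=
    continuous_ofReal_cpow_const (by simpa using hz)
  have hcont : ContinuousOn (fun r : ℝ => (r : ℂ) ^ (-z) * circleCpowIntegral w z r) (Icc 0 1) :=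
    hpow.continuousOn.mul hJ
  have key := intervalIntegral.integral_eq_sub_of_hasDerivAt_of_tendsto zero_lt_one hder hint
    ((hcont 0 (by simp)).mono_of_mem_nhdsWithin (Icc_mem_nhdsGT zero_lt_one)).tendsto
    ((hcont 1 (by simp)).mono_of_mem_nhdsWithin (Icc_mem_nhdsLT zero_lt_one)).tendsto
  rw [intervalIntegral.integral_const_mul] at key
  simp only [ofReal_zero, zero_cpow hz0, zero_mul, sub_zero, ofReal_one, one_cpow, one_mul] at key
  rw [← key, betaIntegral]

theorem differentiable_circleCpowIntegral_one (hw : -1 < w.re) :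
    Differentiable ℂ fun z => circleCpowIntegral w z 1 := by
  intro z₀
  obtain ⟨g, hg, hb⟩ := exists_bound_one_add_mul_exp_cpow_mul_exp hw (‖z₀‖ + 1)
  refine (intervalIntegral.hasDerivAt_integral_of_dominated_loc_of_deriv_le
    (μ := volume) (a := -π) (b := π) (bound := fun θ => g θ * π)
    (F := fun (z : ℂ) (θ : ℝ) => (1 + (1 : ℝ) * exp (θ * I)) ^ w * exp (-(θ * I * z)))
    (F' := fun z θ => (1 + (1 : ℝ) * exp (θ * I)) ^ w * exp (-(θ * I * z)) * -(θ * I))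
    (Metric.ball_mem_nhds z₀ one_pos) ?_ ?_ ?_ ?_ (hg.mul_const _) ?_).2.differentiableAt
  · exact .of_forall fun z =>
      ((measurable_one_add_mul_exp_cpow w 1).mul (by fun_prop)).aestronglyMeasurable
  · exact intervalIntegrable_one_add_mul_exp_cpow_mul_exp hw z₀ (by simp)
  · exact (((measurable_one_add_mul_exp_cpow w 1).mul (by fun_prop)).mul
      (by fun_prop)).aestronglyMeasurable
  · refine ae_mem_uIoc_neg_pi_pi fun θ hθ z hz => ?_
    have hzn : ‖z‖ ≤ ‖z₀‖ + 1 := by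
      have := norm_sub_norm_le z z₀
      have := mem_ball_iff_norm.1 hz
      linarith
    have h1 := hb 1 (by simp) θ hθ z hzn
    rw [norm_mul _ (-(θ * I : ℂ)), norm_neg, norm_mul _ I, norm_I, mul_one, norm_real,
      Real.norm_eq_abs]
    exact mul_le_mul h1 (abs_lt.2 hθ).le (abs_nonneg _) ((norm_nonneg _).trans h1)
  · refine ae_mem_uIoc_neg_pi_pi fun θ hθ z hz => ?_
    have h : HasDerivAt (fun z : ℂ => -(θ * I * z)) (-(θ * I * 1)) z :=
      ((hasDerivAt_id z).const_mul (θ * I : ℂ)).neg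
    exact (h.cexp.const_mul _).congr_deriv (by ring)

theorem differentiable_cbinom (w : ℂ) : Differentiable ℂ (cbinom w) := by
  have h : cbinom w = fun z => Gamma (w + 1) * ((Gamma (z + 1))⁻¹ * (Gamma (w - z + 1))⁻¹) := by
    ext z
    rw [cbinom, div_eq_mul_inv, mul_inv]
  rw [h]
  refine (Differentiable.mul ?_ ?_).const_mul _
  · exact differentiable_one_div_Gamma.comp (differentiable_id.add_const 1)
  · exact differentiable_one_div_Gamma.comp
      (((differentiable_const w).sub differentiable_id).add_const 1)

/-- **Cauchy's beta integral**: for `Re w > -1`, the generalized binomial coefficients are the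
Fourier coefficients of `(1 + e^{iθ}) ^ w`. -/
theorem circleCpowIntegral_one_eq_cbinom (hw : -1 < w.re) (z : ℂ) :
    circleCpowIntegral w z 1 = 2 * π * cbinom w z := by
  refine congrFun (f := fun z => circleCpowIntegral w z 1) (AnalyticOnNhd.eq_of_eventuallyEq
    (g := fun z => 2 * π * cbinom w z) (z₀ := -(1 / 2))
    (analyticOnNhd_univ_iff_differentiable.2 (differentiable_circleCpowIntegral_one hw))
    (analyticOnNhd_univ_iff_differentiable.2 ((differentiable_cbinom w).const_mul _)) ?_) z
  have hre : ∀ᶠ z : ℂ in 𝓝 (-(1 / 2)), z.re < 0 :=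
    continuous_re.continuousAt.eventually_lt continuousAt_const (by norm_num)
  have hsin : ∀ᶠ z : ℂ in 𝓝 (-(1 / 2)), sin (π * z) ≠ 0 := by
    have hc : Continuous fun z : ℂ => sin (π * z) := by fun_prop
    refine hc.continuousAt.eventually_ne ?_
    rw [mul_neg, sin_neg, mul_one_div, sin_pi_div_two]
    simp
  filter_upwards [hre, hsin] with z hz hs
  have hG : Gamma (w - z + 1) ≠ 0 := Gamma_ne_zero_of_re_pos (by simp; linarith)
  have hG1 : Gamma (z + 1) ≠ 0 := by
    intro h
    have := Gamma_mul_Gamma_one_sub (-z)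
    rw [sub_neg_eq_add, add_comm 1 z, h, mul_zero, mul_neg, sin_neg, eq_comm, div_eq_zero_iff,
      neg_eq_zero] at this
    simp [hs, Real.pi_ne_zero] at this
  have hβ := Gamma_mul_Gamma_eq_betaIntegral (s := -z) (t := w + 1) (by simpa using hz)
    (by simp; linarith)
  have hrefl : Gamma (-z) * Gamma (z + 1) * sin (π * z) = -π := by
    have := Gamma_mul_Gamma_one_sub (-z)
    rw [sub_neg_eq_add, add_comm 1 z, mul_neg, sin_neg, div_neg] at this
    rw [this, neg_mul, div_mul_cancel₀ _ hs]
  rw [show -z + (w + 1) = w - z + 1 by ring] at hβ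
  rw [circleCpowIntegral_one_eq_betaIntegral hw hz, cbinom]
  field_simp
  linear_combination sin (π * z) * Gamma (z + 1) * hβ - Gamma (w + 1) * hrefl

end Cauchy

section Kernel

variable {α : ℂ}

theorem exists_mul_one_add_sq_le_norm_sq_add_sq (hα : 0 < α.re) :
    ∃ c : ℝ, 0 < c ∧ ∀ x : ℝ, c * (1 + x ^ 2) ≤ ‖(x : ℂ) ^ 2 + α ^ 2‖ := by
  obtain ⟨a, b⟩ := α
  replace hα : 0 < a := hα
  set c : ℝ := a ^ 2 / (1 + a ^ 2 + b ^ 2) with hc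
  have hden : 0 < 1 + a ^ 2 + b ^ 2 := by positivity
  have hcpos : 0 < c := by positivity
  have hceq : c * (1 + a ^ 2 + b ^ 2) = a ^ 2 := div_mul_cancel₀ _ hden.ne'
  have hc1 : 0 < 1 - c := by
    rw [hc, sub_pos, div_lt_one hden]; nlinarith [sq_nonneg b]
  clear_value c
  have hb : ∀ x : ℝ, c * (1 + x ^ 2) ≤ (x - b) ^ 2 + a ^ 2 := by
    intro x
    have h : 0 ≤ ((1 - c) * x - b) ^ 2 + c ^ 2 := by positivity
    have h2 : ((1 - c) * x - b) ^ 2 + c ^ 2 =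
        (1 - c) * ((x - b) ^ 2 + a ^ 2 - c * (1 + x ^ 2)) := by
      linear_combination hceq
    rw [h2] at h
    linarith [nonneg_of_mul_nonneg_right h hc1]
  refine ⟨c, hcpos, fun x => ?_⟩
  refine Real.le_sqrt_of_sq_le ?_ |>.trans_eq (norm_def _).symm
  have h1 := hb x
  have h2 := hb (-x)
  have h0 : 0 ≤ c * (1 + x ^ 2) := by positivity
  have hmul := mul_le_mul h1 (by simpa using h2) h0 (h0.trans h1)
  simp only [normSq_apply, add_re, add_im, pow_two, mul_re, mul_im, ofReal_re, ofReal_im]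
  nlinarith

theorem sq_add_sq_ne_zero (hα : 0 < α.re) (x : ℝ) : (x : ℂ) ^ 2 + α ^ 2 ≠ 0 := by
  obtain ⟨c, hc, h⟩ := exists_mul_one_add_sq_le_norm_sq_add_sq hα
  refine norm_pos_iff.1 (lt_of_lt_of_le ?_ (h x))
  positivity

theorem integrable_inv_sq_add_sq (hα : 0 < α.re) :
    Integrable fun x : ℝ => ((x : ℂ) ^ 2 + α ^ 2)⁻¹ := by
  obtain ⟨c, hc, h⟩ := exists_mul_one_add_sq_le_norm_sq_add_sq hα
  refine (integrable_inv_one_add_sq.const_mul c⁻¹).mono' ?_ (.of_forall fun x => ?_)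
  · exact (Continuous.inv₀ (by fun_prop) (sq_add_sq_ne_zero hα)).aestronglyMeasurable
  · rw [norm_inv, ← mul_inv]
    have := h x
    gcongr

theorem summable_norm_inv_int_sq_add_sq (hα : 0 < α.re) :
    Summable fun k : ℤ => ‖((k : ℂ) ^ 2 + α ^ 2)⁻¹‖ := by
  obtain ⟨c, hc, h⟩ := exists_mul_one_add_sq_le_norm_sq_add_sq hα
  refine Summable.of_norm_bounded_eventually
    (((Real.summable_one_div_int_pow (p := 2)).2 one_lt_two).mul_left c⁻¹)
    ?_
  filter_upwards [(Set.finite_singleton (0 : ℤ)).compl_mem_cofinite] with k hk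
  have hk0 : (k : ℝ) ≠ 0 := by exact_mod_cast hk
  rw [norm_norm, norm_inv, one_div, ← mul_inv]
  have h1 := h k
  rw [ofReal_intCast] at h1
  have : 0 < (k : ℝ) ^ 2 := by positivity
  gcongr
  nlinarith

theorem integrable_exp_neg_mul_abs (hα : 0 < α.re) :
    Integrable fun t : ℝ => exp (-(α * |t|)) := by
  rw [← integrableOn_univ, ← Iic_union_Ioi (a := (0 : ℝ)), integrableOn_union]
  constructor
  · refine (integrableOn_exp_mul_complex_Iic hα 0).congr_fun (fun t ht => ?_) measurableSet_Iic
    simp [abs_of_nonpos (mem_Iic.1 ht)]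
  · refine (integrableOn_exp_mul_complex_Ioi (a := -α) (by simpa) 0).congr_fun
      (fun t ht => ?_) measurableSet_Ioi
    simp [abs_of_pos (mem_Ioi.1 ht)]

theorem add_mul_I_ne_zero (hα : 0 < α.re) (x : ℝ) : α + x * I ≠ 0 := fun h => by
  have := congrArg re h
  simp at this
  linarith

theorem sub_mul_I_ne_zero (hα : 0 < α.re) (x : ℝ) : α - x * I ≠ 0 := fun h => by
  have := congrArg re h
  simp at this
  linarith

theorem inv_add_mul_I_add_inv_sub_mul_I (hα : 0 < α.re) (x : ℝ) :
    (α + x * I)⁻¹ + (α - x * I)⁻¹ = 2 * α * ((x : ℂ) ^ 2 + α ^ 2)⁻¹ := by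
  have h1 := add_mul_I_ne_zero hα x
  have h2 := sub_mul_I_ne_zero hα x
  have h3 : (x : ℂ) ^ 2 + α ^ 2 = (α + x * I) * (α - x * I) := by
    linear_combination (x : ℂ) ^ 2 * I_sq
  rw [h3]
  field_simp
  ring

theorem fourier_exp_neg_mul_abs (hα : 0 < α.re) (ξ : ℝ) :
    FourierTransform.fourier (fun t : ℝ => exp (-(α * |t|))) ξ =
      2 * α * (((2 * π * ξ : ℝ) : ℂ) ^ 2 + α ^ 2)⁻¹ := by
  rw [Real.fourier_real_eq_integral_exp_smul]
  set x : ℝ := 2 * π * ξ with hx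
  have hl : EqOn (fun t : ℝ => exp ((α - x * I) * t))
      (fun t : ℝ => exp (↑(-2 * π * t * ξ) * I) • exp (-(α * |t|))) (Iic 0) := fun t ht => by
    simp only [smul_eq_mul, ← exp_add, abs_of_nonpos (mem_Iic.1 ht), hx]
    push_cast
    ring_nf
  have hr : EqOn (fun t : ℝ => exp (-(α + x * I) * t))
      (fun t : ℝ => exp (↑(-2 * π * t * ξ) * I) • exp (-(α * |t|))) (Ioi 0) := fun t ht => by
    simp only [smul_eq_mul, ← exp_add, abs_of_pos (mem_Ioi.1 ht), hx]
    push_cast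
    ring_nf
  have hα1 : 0 < (α - x * I).re := by simpa
  have hα2 : (-(α + x * I)).re < 0 := by simpa
  rw [← intervalIntegral.integral_Iic_add_Ioi (b := 0)
      ((integrableOn_exp_mul_complex_Iic hα1 0).congr_fun hl measurableSet_Iic)
      ((integrableOn_exp_mul_complex_Ioi hα2 0).congr_fun hr measurableSet_Ioi),
    ← setIntegral_congr_fun measurableSet_Iic hl, ← setIntegral_congr_fun measurableSet_Ioi hr,
    integral_exp_mul_complex_Iic hα1, integral_exp_mul_complex_Ioi hα2,
    ← inv_add_mul_I_add_inv_sub_mul_I hα]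
  simp only [ofReal_zero, mul_zero, exp_zero, neg_div_neg_eq, one_div]
  ring

theorem integral_exp_mul_inv_sq_add_sq (hα : 0 < α.re) (t : ℝ) :
    ∫ x : ℝ, exp (t * x * I) * ((x : ℂ) ^ 2 + α ^ 2)⁻¹ = π / α * exp (-(α * |t|)) := by
  have hα0 : α ≠ 0 := fun h => by simp [h] at hα
  have hF : FourierTransform.fourier (fun t : ℝ => exp (-(α * |t|))) =
      fun ξ : ℝ => 2 * α * (((2 * π * ξ : ℝ) : ℂ) ^ 2 + α ^ 2)⁻¹ :=
    funext (fourier_exp_neg_mul_abs hα)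
  have hint : Integrable (FourierTransform.fourier (fun t : ℝ => exp (-(α * |t|)))) := by
    rw [hF]
    exact ((integrable_inv_sq_add_sq hα).comp_mul_left' (by positivity)).const_mul _
  have hcont : Continuous fun t : ℝ => exp (-(α * |t|)) := by fun_prop
  have key := (integrable_exp_neg_mul_abs hα).fourierInv_fourier_eq hint
    (hcont.continuousAt (x := t))
  rw [hF, Real.fourierInv_eq'] at key
  have hsub := Measure.integral_comp_mul_left
    (fun x : ℝ => exp (t * x * I) * ((x : ℂ) ^ 2 + α ^ 2)⁻¹) (2 * π)
  rw [← key]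
  have : ∀ v : ℝ, exp (↑(2 * π * inner ℝ v t) * I) •
      (2 * α * (((2 * π * v : ℝ) : ℂ) ^ 2 + α ^ 2)⁻¹) =
      2 * α * (exp (t * (2 * π * v : ℝ) * I) * (((2 * π * v : ℝ) : ℂ) ^ 2 + α ^ 2)⁻¹) := by
    intro v
    simp only [smul_eq_mul, RCLike.inner_apply, conj_trivial]
    push_cast
    ring_nf
  simp_rw [this]
  rw [integral_const_mul, hsub, abs_of_pos (by positivity), real_smul]
  generalize (∫ x : ℝ, exp (t * x * I) * ((x : ℂ) ^ 2 + α ^ 2)⁻¹) = J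
  push_cast
  field_simp

theorem hasSum_exp_mul_inv_sq_add_sq_of_nonneg (hα : 0 < α.re) {t : ℝ} (ht : t ∈ Icc 0 π) :
    HasSum (fun k : ℤ => exp (t * k * I) * ((k : ℂ) ^ 2 + α ^ 2)⁻¹)
      (π / α * (exp (α * (π - t)) + exp (-(α * (π - t)))) / (exp (π * α) - exp (-(π * α)))) := by
  have hπ := Real.pi_pos
  have hα0 : α ≠ 0 := fun h => by simp [h] at hα
  have hexp : exp (π * α) - exp (-(π * α)) ≠ 0 := by
    intro h
    have h1 := congrArg norm (sub_eq_zero.1 h)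
    rw [norm_exp, norm_exp, Real.exp_eq_exp] at h1
    simp at h1
    nlinarith
  have : Fact (0 < 2 * π) := ⟨by positivity⟩
  set f : ℝ → ℂ := fun x => exp (α * (π - x)) + exp (-(α * (π - x))) with hf
  have hfc : Continuous (AddCircle.liftIco (2 * π) 0 f) := by
    refine AddCircle.liftIco_continuous ?_ (by fun_prop)
    simp only [hf]
    push_cast
    rw [add_comm]
    ring_nf
  have hcoef : ∀ k : ℤ, fourierCoeff (AddCircle.liftIco (2 * π) 0 f) k =
      α / π * (exp (π * α) - exp (-(π * α))) * ((k : ℂ) ^ 2 + α ^ 2)⁻¹ := by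
    intro k
    have h1 := add_mul_I_ne_zero hα k
    have h2 := sub_mul_I_ne_zero hα k
    rw [ofReal_intCast] at h1 h2
    have hinv := inv_add_mul_I_add_inv_sub_mul_I hα k
    rw [ofReal_intCast] at hinv
    rw [fourierCoeff_liftIco_eq, fourierCoeffOn_eq_integral]
    have hper : exp (-(k * (2 * π * I))) = 1 := by
      rw [exp_neg, exp_int_mul_two_pi_mul_I, inv_one]
    have hint : ∀ x : ℝ, fourier (-k) (x : AddCircle (0 + 2 * π - 0)) • f x =
        exp (π * α) * exp (-(α + k * I) * x) + exp (-(π * α)) * exp ((α - k * I) * x) := by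
      intro x
      rw [fourier_coe_apply, smul_eq_mul, hf, mul_add, ← exp_add, ← exp_add, ← exp_add, ← exp_add]
      push_cast
      congr 2 <;> field_simp <;> ring
    simp_rw [hint]
    rw [intervalIntegral.integral_add (Continuous.intervalIntegrable (by fun_prop) _ _)
      (Continuous.intervalIntegrable (by fun_prop) _ _), intervalIntegral.integral_const_mul,
      intervalIntegral.integral_const_mul, integral_exp_mul_complex (neg_ne_zero.2 h1),
      integral_exp_mul_complex h2]
    have e1 : exp (-(α + k * I) * (0 + 2 * π : ℝ)) = exp (-(π * α)) * exp (-(π * α)) := by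
      rw [← exp_add, ← mul_one (exp (-(π * α) + _)), ← hper, ← exp_add]
      push_cast; ring_nf
    have e2 : exp ((α - k * I) * (0 + 2 * π : ℝ)) = exp (π * α) * exp (π * α) := by
      rw [← exp_add, ← mul_one (exp (π * α + _)), ← hper, ← exp_add]
      push_cast; ring_nf
    have e3 : exp (π * α) * exp (-(π * α)) = 1 := by rw [← exp_add, add_neg_cancel, exp_zero]
    rw [e1, e2, ofReal_zero, mul_zero, mul_zero, exp_zero, real_smul]
    push_cast
    rw [div_neg, ← neg_div, neg_sub, div_eq_mul_inv _ (α + _), div_eq_mul_inv _ (α - _)]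
    set E := exp (π * α)
    set E' := exp (-(π * α))
    set A := (α + k * I)⁻¹
    set B := (α - k * I)⁻¹
    have hπ0 : (π : ℂ) ≠ 0 := by exact_mod_cast hπ.ne'
    have : E * ((1 - E' * E') * A) + E' * ((E * E - 1) * B) = (E - E') * (A + B) := by
      linear_combination (E * B - E' * A) * e3
    rw [this, hinv]
    field_simp
    ring
  have hsum : Summable (fourierCoeff (⟨_, hfc⟩ : C(AddCircle (2 * π), ℂ))) := by
    simp only [ContinuousMap.coe_mk]
    rw [show fourierCoeff (AddCircle.liftIco (2 * π) 0 f) = _ from funext hcoef]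
    exact (summable_norm_inv_int_sq_add_sq hα).of_norm.mul_left _
  have key := has_pointwise_sum_fourier_series_of_summable hsum (t : AddCircle (2 * π))
  simp only [ContinuousMap.coe_mk] at key
  rw [AddCircle.liftIco_coe_apply (by constructor <;> linarith [ht.1, ht.2])] at key
  simp_rw [hcoef] at key
  have hπ0 : (π : ℂ) ≠ 0 := by exact_mod_cast hπ.ne'
  have hterm : (fun k : ℤ => exp (t * k * I) * ((k : ℂ) ^ 2 + α ^ 2)⁻¹) = fun k : ℤ =>
      π / α * (exp (π * α) - exp (-(π * α)))⁻¹ *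
        ((α / π * (exp (π * α) - exp (-(π * α))) * ((k : ℂ) ^ 2 + α ^ 2)⁻¹) •
          fourier k (t : AddCircle (2 * π))) := by
    ext k
    rw [fourier_coe_apply, smul_eq_mul]
    have : 2 * π * I * k * t / (2 * π : ℝ) = t * k * I := by
      push_cast; field_simp
    rw [this]
    generalize exp (π * α) - exp (-(π * α)) = D at hexp ⊢
    field_simp
  rw [hterm, show π / α * (exp (α * (π - t)) + exp (-(α * (π - t)))) /
    (exp (π * α) - exp (-(π * α))) = π / α * (exp (π * α) - exp (-(π * α)))⁻¹ * f t by
    simp only [hf, div_eq_mul_inv]; ring]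
  exact key.mul_left _

/-- The defect in Poisson summation for `(x² + α²)⁻¹` at a frequency `|t| ≤ π`. -/
theorem hasSum_exp_mul_inv_sq_add_sq (hα : 0 < α.re) {t : ℝ} (ht : |t| ≤ π) :
    HasSum (fun k : ℤ => exp (-(t * k * I)) * ((k : ℂ) ^ 2 + α ^ 2)⁻¹)
      ((∫ x : ℝ, exp (-(t * x * I)) * ((x : ℂ) ^ 2 + α ^ 2)⁻¹) +
        π / (α * (exp (2 * π * α) - 1)) * (exp (α * t) + exp (-(α * t)))) := by
  have hα0 : α ≠ 0 := fun h => by simp [h] at hα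
  have hexp : exp (2 * π * α) - 1 ≠ 0 := by
    intro h
    have h1 := congrArg norm (sub_eq_zero.1 h)
    rw [norm_exp, norm_one, Real.exp_eq_one_iff] at h1
    simp [Real.pi_ne_zero] at h1
    exact hα.ne' h1
  have hint := integral_exp_mul_inv_sq_add_sq hα (-t)
  simp only [ofReal_neg, neg_mul, abs_neg] at hint
  rw [hint]
  have hval : π / α * (exp (α * (π - |t|)) + exp (-(α * (π - |t|)))) /
      (exp (π * α) - exp (-(π * α))) =
      π / α * exp (-(α * |t|)) + π / (α * (exp (2 * π * α) - 1)) *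
        (exp (α * |t|) + exp (-(α * |t|))) := by
    have h1 : exp (π * α) - exp (-(π * α)) = (exp (2 * π * α) - 1) * exp (-(π * α)) := by
      rw [sub_mul, ← exp_add, one_mul]; ring_nf
    have h2 : exp (α * (π - |t|)) = exp (2 * π * α) * exp (-(α * |t|)) * exp (-(π * α)) := by
      rw [← exp_add, ← exp_add]; ring_nf
    have h3 : exp (-(α * (π - |t|))) = exp (α * |t|) * exp (-(π * α)) := by
      rw [← exp_add]; ring_nf
    rw [h1, h2, h3]
    have h4 := exp_ne_zero (-(π * α))
    generalize exp (2 * π * α) = E at hexp ⊢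
    generalize exp (-(π * α)) = E' at h4 ⊢
    field_simp
    ring
  have key := hasSum_exp_mul_inv_sq_add_sq_of_nonneg hα (t := |t|) ⟨abs_nonneg t, ht⟩
  rw [hval] at key
  rcases abs_cases t with ⟨h, -⟩ | ⟨h, -⟩
  · rw [h] at key ⊢
    convert (Equiv.neg ℤ).hasSum_iff.2 key using 2 with k
    simp
  · rw [h] at key ⊢
    simp only [ofReal_neg, mul_neg, neg_mul, neg_neg] at key ⊢
    rw [add_comm (exp (α * t))]
    exact key

end Kernel

section Assembly

variable {w α : ℂ}

theorem intervalIntegrable_one_add_exp_cpow (hw : -1 < w.re) :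
    IntervalIntegrable (fun θ : ℝ => (1 + (1 : ℝ) * exp (θ * I)) ^ w) volume (-π) π := by
  simpa using intervalIntegrable_one_add_mul_exp_cpow_mul_exp hw 0 (r := 1) (by simp)

theorem integral_cbinom_div_eq_intervalIntegral (hw : -1 < w.re) (hα : 0 < α.re) :
    ∫ θ in -π..π, (1 + (1 : ℝ) * exp (θ * I)) ^ w *
        ∫ x : ℝ, exp (-(θ * x * I)) * ((x : ℂ) ^ 2 + α ^ 2)⁻¹ =
      2 * π * ∫ x : ℝ, cbinom w x / ((x : ℂ) ^ 2 + α ^ 2) := by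
  have hP := (intervalIntegrable_one_add_exp_cpow hw).def'
  have hint : Integrable (Function.uncurry fun θ x : ℝ =>
      (1 + (1 : ℝ) * exp (θ * I)) ^ w * (exp (-(θ * x * I)) * ((x : ℂ) ^ 2 + α ^ 2)⁻¹))
      ((volume.restrict (uIoc (-π) π)).prod volume) := by
    refine ((hP.mul_prod (integrable_inv_sq_add_sq hα)).bdd_mul (c := 1)
      (f := fun p : ℝ × ℝ => exp (-(p.1 * p.2 * I))) (by fun_prop)
      (.of_forall fun p => ?_)).congr (.of_forall fun p => ?_)
    · rw [← ofReal_mul, ← neg_mul, ← ofReal_neg, norm_exp_ofReal_mul_I]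
    · simp only [Function.uncurry]
      ring
  simp_rw [← integral_const_mul]
  rw [intervalIntegral_integral_swap hint]
  refine integral_congr_ae (.of_forall fun x => ?_)
  beta_reduce
  rw [← mul_div_assoc, ← circleCpowIntegral_one_eq_cbinom hw, circleCpowIntegral, div_eq_mul_inv,
    ← intervalIntegral.integral_mul_const]
  congr 1 with θ
  rw [mul_right_comm (θ : ℂ) x I]
  ring

theorem hasSum_cbinom_div_intervalIntegral (hw : -1 < w.re) (hα : 0 < α.re) :
    HasSum (fun k : ℤ => 2 * π * (cbinom w k / ((k : ℂ) ^ 2 + α ^ 2)))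
      (∫ θ in -π..π, (1 + (1 : ℝ) * exp (θ * I)) ^ w *
        ((∫ x : ℝ, exp (-(θ * x * I)) * ((x : ℂ) ^ 2 + α ^ 2)⁻¹) +
          π / (α * (exp (2 * π * α) - 1)) * (exp (α * θ) + exp (-(α * θ))))) := by
  have hP := intervalIntegrable_one_add_exp_cpow hw
  have hsum := summable_norm_inv_int_sq_add_sq hα
  have key := intervalIntegral.hasSum_integral_of_dominated_convergence (μ := volume)
    (a := -π) (b := π)
    (F := fun (k : ℤ) (θ : ℝ) => (1 + (1 : ℝ) * exp (θ * I)) ^ w *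
      (exp (-(θ * k * I)) * ((k : ℂ) ^ 2 + α ^ 2)⁻¹))
    (f := fun θ => (1 + (1 : ℝ) * exp (θ * I)) ^ w *
        ((∫ x : ℝ, exp (-(θ * x * I)) * ((x : ℂ) ^ 2 + α ^ 2)⁻¹) +
          π / (α * (exp (2 * π * α) - 1)) * (exp (α * θ) + exp (-(α * θ)))))
    (fun k θ => ‖(1 + (1 : ℝ) * exp (θ * I)) ^ w‖ * ‖((k : ℂ) ^ 2 + α ^ 2)⁻¹‖)
    (fun k => ((measurable_one_add_mul_exp_cpow w 1).mul (by fun_prop)).aestronglyMeasurable)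
    (fun k => .of_forall fun θ _ => ?_)
    (.of_forall fun θ _ => hsum.mul_left _) ?_
    (ae_mem_uIoc_neg_pi_pi fun θ hθ =>
      (hasSum_exp_mul_inv_sq_add_sq hα (abs_lt.2 hθ).le).mul_left _)
  · refine key.congr_fun fun k => ?_
    rw [← mul_div_assoc, ← circleCpowIntegral_one_eq_cbinom hw, circleCpowIntegral,
      div_eq_mul_inv, ← intervalIntegral.integral_mul_const]
    congr 1 with θ
    ring_nf
  · rw [norm_mul, norm_mul, ← ofReal_intCast, ← ofReal_mul, ← neg_mul, ← ofReal_neg,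
      norm_exp_ofReal_mul_I, one_mul]
  · simp_rw [tsum_mul_left]
    exact hP.norm.mul_const _

theorem cbinom_intCast_eq_zero_of_notMem_range (w : ℂ) {k : ℤ}
    (hk : k ∉ range (Nat.cast : ℕ → ℤ)) : cbinom w k = 0 := by
  have hneg : k < 0 := by
    by_contra! h
    exact hk ⟨k.toNat, Int.toNat_of_nonneg h⟩
  have h : (k : ℂ) + 1 = -((-(k + 1)).toNat : ℕ) := by
    have : ((-(k + 1)).toNat : ℤ) = -(k + 1) := Int.toNat_of_nonneg (by omega)
    rw [← Int.cast_natCast, this]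
    push_cast
    ring
  rw [cbinom, h, Gamma_neg_nat_eq_zero, zero_mul, div_zero]

end Assembly

theorem integral_binom_div_quadratic (w : ℂ) (hw : -1 < w.re) (α : ℂ) (hα : 0 < α.re) :
    ∫ x : ℝ, cbinom w (x : ℂ) / ((x : ℂ) ^ 2 + α ^ 2) =
      (∑' k : ℕ, cbinom w (k : ℂ) / ((k : ℂ) ^ 2 + α ^ 2)) -
        (π : ℂ) / (α * (Complex.exp (2 * π * α) - 1)) *
          (cbinom w (Complex.I * α) + cbinom w (-(Complex.I * α))) := by
  have hπ0 : (π : ℂ) ≠ 0 := by exact_mod_cast Real.pi_ne_zero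
  have hP := intervalIntegrable_one_add_exp_cpow hw
  have hsum := hasSum_cbinom_div_intervalIntegral hw hα
  have hK : IntervalIntegrable (fun θ : ℝ => (1 + (1 : ℝ) * exp (θ * I)) ^ w *
      ∫ x : ℝ, exp (-(θ * x * I)) * ((x : ℂ) ^ 2 + α ^ 2)⁻¹) volume (-π) π := by
    refine hP.mul_continuousOn (Continuous.continuousOn ?_)
    have h : (fun θ : ℝ => ∫ x : ℝ, exp (-(θ * x * I)) * ((x : ℂ) ^ 2 + α ^ 2)⁻¹) =
        fun θ : ℝ => π / α * exp (-(α * |θ|)) := by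
      ext θ
      simpa using integral_exp_mul_inv_sq_add_sq hα (-θ)
    rw [h]
    fun_prop
  have h1 : IntervalIntegrable (fun θ : ℝ => (1 + (1 : ℝ) * exp (θ * I)) ^ w * exp (α * θ))
      volume (-π) π := hP.mul_continuousOn (by fun_prop)
  have h2 : IntervalIntegrable (fun θ : ℝ => (1 + (1 : ℝ) * exp (θ * I)) ^ w * exp (-(α * θ)))
      volume (-π) π := hP.mul_continuousOn (by fun_prop)
  have e1 : ∫ θ in -π..π, (1 + (1 : ℝ) * exp (θ * I)) ^ w * exp (α * θ) =
      2 * π * cbinom w (I * α) := by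
    rw [← circleCpowIntegral_one_eq_cbinom hw, circleCpowIntegral]
    congr 1 with θ
    congr 2
    linear_combination θ * α * I_sq
  have e2 : ∫ θ in -π..π, (1 + (1 : ℝ) * exp (θ * I)) ^ w * exp (-(α * θ)) =
      2 * π * cbinom w (-(I * α)) := by
    rw [← circleCpowIntegral_one_eq_cbinom hw, circleCpowIntegral]
    congr 1 with θ
    congr 2
    linear_combination -(θ * α) * I_sq
  have hsplit : ∀ θ : ℝ, (1 + (1 : ℝ) * exp (θ * I)) ^ w *
      ((∫ x : ℝ, exp (-(θ * x * I)) * ((x : ℂ) ^ 2 + α ^ 2)⁻¹) +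
        π / (α * (exp (2 * π * α) - 1)) * (exp (α * θ) + exp (-(α * θ)))) =
      (1 + (1 : ℝ) * exp (θ * I)) ^ w *
        (∫ x : ℝ, exp (-(θ * x * I)) * ((x : ℂ) ^ 2 + α ^ 2)⁻¹) +
      π / (α * (exp (2 * π * α) - 1)) * ((1 + (1 : ℝ) * exp (θ * I)) ^ w * exp (α * θ) +
        (1 + (1 : ℝ) * exp (θ * I)) ^ w * exp (-(α * θ))) := fun θ => by ring
  simp_rw [hsplit] at hsum
  rw [intervalIntegral.integral_add hK ((h1.add h2).const_mul _),
    intervalIntegral.integral_const_mul, intervalIntegral.integral_add h1 h2, e1, e2,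
    integral_cbinom_div_eq_intervalIntegral hw hα] at hsum
  have htsum := hsum.tsum_eq
  rw [tsum_mul_left, ← (Nat.cast_injective (R := ℤ)).tsum_eq
    (Function.support_subset_iff'.2 fun k hk => by
      rw [cbinom_intCast_eq_zero_of_notMem_range w hk, zero_div])] at htsum
  simp only [Int.cast_natCast] at htsum
  rw [eq_sub_iff_add_eq]
  refine (mul_left_cancel₀ (mul_ne_zero two_ne_zero hπ0) ?_).symm
  rw [htsum]
  ring
end
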